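/- Let 𝒪 ⊂ ℝ^d be a bounded domain, and suppose Assumptions B–E hold and Assumption A1 holds with p > 1 and s = 1 − 1/p. Suppose u is a viscosity subsolution and v a viscosity supersolution of (E) with u(x) ≤ v(x) for all x ∉ 𝒪. If either u or v is of class C¹ on 𝒪, then u(x) ≤ v(x) for all x ∈ 𝒪. -/

import Mathlib

open MeasureTheory Set Metric Filter
open scoped ENNReal NNReal

noncomputable section

abbrev Euc (d : ℕ) := EuclideanSpace ℝ (Fin d)

variable {d : ℕ} {A B : Type*}

/-- `μ ∈ 𝕃_p(ℝ^d)`: a positive Borel measure on `ℝ^d ∖ {0}` (modeled as a measure on `ℝ^d`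
vanishing on `{0}`) with `N_p(μ) = ∫ min(1,|z|^p) dμ < ∞`. -/
def IsLevyLp (p : ℝ) (μ : Measure (Euc d)) : Prop :=
  μ {0} = 0 ∧ ∫⁻ z, ENNReal.ofReal (min 1 (‖z‖ ^ p)) ∂μ < ⊤

/-- `μ ∈ 𝕃_p(Ω)`: member of `𝕃_p(ℝ^d)` giving no mass to the complement of `Ω`. -/
def IsLevyLpOn (p : ℝ) (Ω : Set (Euc d)) (μ : Measure (Euc d)) : Prop :=
  IsLevyLp p μ ∧ μ Ωᶜ = 0

/-- `μ ∈ M_p(ℝ^d)`: Lévy measure with finite `p`-moment. -/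
def IsMp (p : ℝ) (μ : Measure (Euc d)) : Prop :=
  IsLevyLp p μ ∧ ∫⁻ z, ENNReal.ofReal (‖z‖ ^ p) ∂μ < ⊤

/-- Admissible transport plans between `μ₁` and `μ₂`: positive Borel measures on `ℝ^d × ℝ^d`
with no mass at `(0,0)` whose marginals, restricted to `ℝ^d ∖ {0}`, are `μ₁` and `μ₂`. -/
def AdmPlan (μ₁ μ₂ : Measure (Euc d)) : Set (Measure (Euc d × Euc d)) :=
  {γ | γ {((0 : Euc d), (0 : Euc d))} = 0 ∧
       (γ.map Prod.fst).restrict {(0 : Euc d)}ᶜ = μ₁ ∧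
       (γ.map Prod.snd).restrict {(0 : Euc d)}ᶜ = μ₂}

/-- The transport cost functional `J_p(γ) = ∫ |x-y|^p dγ`. -/
def Jp (p : ℝ) (γ : Measure (Euc d × Euc d)) : ℝ≥0∞ :=
  ∫⁻ q, ENNReal.ofReal (‖q.1 - q.2‖ ^ p) ∂γ

/-- `d_{𝕃_p}(μ,ν)^p` as an extended nonnegative real. -/
def dLpPow (p : ℝ) (μ ν : Measure (Euc d)) : ℝ≥0∞ :=
  ⨅ γ ∈ AdmPlan μ ν, Jp p γ

/-- The transport distance `d_{𝕃_p}`. -/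
def dLp (p : ℝ) (μ ν : Measure (Euc d)) : ℝ :=
  (dLpPow p μ ν).toReal ^ (1 / p)

/-- Total variation distance `|μ - ν|(X)` between two positive measures. -/
def dTV {X : Type*} [MeasurableSpace X] (μ ν : Measure X) : ℝ≥0∞ :=
  (⨆ (s : Set X) (_ : MeasurableSet s), μ s - ν s) +
  (⨆ (s : Set X) (_ : MeasurableSet s), ν s - μ s)

/-- A modulus of continuity. -/
def IsModulus (θ : ℝ → ℝ) : Prop :=
  (∀ r, 0 ≤ θ r) ∧ Monotone θ ∧ Tendsto θ (nhdsWithin 0 (Ioi 0)) (nhds 0)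

/-- Bounded uniformly continuous functions on `ℝ^d`. -/
def IsBUC (u : Euc d → ℝ) : Prop :=
  (∃ M, ∀ x, |u x| ≤ M) ∧ UniformContinuous u

/-- The Lévy operator `L_μ(φ,x) = ∫ [φ(x+z) - φ(x) - χ_{B₁}(z) Dφ(x)·z] dμ(z)`. -/
def Lop (μ : Measure (Euc d)) (φ : Euc d → ℝ) (x : Euc d) : ℝ :=
  ∫ z, (φ (x + z) - φ x -
    (ball (0 : Euc d) 1).indicator (fun w => fderiv ℝ φ x w) z) ∂μ

/-- The operator `I(φ,x) = sup_α inf_β { -L^{αβ}(φ,x) + c_{αβ}(x) φ(x) + f_{αβ}(x) }`. -/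
def Iop (μf : Euc d → A → B → Measure (Euc d)) (c f : A → B → Euc d → ℝ)
    (φ : Euc d → ℝ) (x : Euc d) : ℝ :=
  ⨆ α : A, ⨅ β : B, (-(Lop (μf x α β) φ x) + c α β x * φ x + f α β x)

/-- Viscosity subsolution of `J(u,x) = 0` in `O`. -/
def IsSubsolution (O : Set (Euc d)) (J : (Euc d → ℝ) → Euc d → ℝ) (u : Euc d → ℝ) : Prop :=
  ∀ φ : Euc d → ℝ, ContDiff ℝ 2 φ → (∃ M, ∀ x, |φ x| ≤ M) →
    ∀ x ∈ O, (∀ y, u y - φ y ≤ u x - φ x) → φ x = u x → J φ x ≤ 0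

/-- Viscosity supersolution of `J(u,x) = 0` in `O`. -/
def IsSupersolution (O : Set (Euc d)) (J : (Euc d → ℝ) → Euc d → ℝ) (u : Euc d → ℝ) : Prop :=
  ∀ φ : Euc d → ℝ, ContDiff ℝ 2 φ → (∃ M, ∀ x, |φ x| ≤ M) →
    ∀ x ∈ O, (∀ y, u x - φ x ≤ u y - φ y) → φ x = u x → 0 ≤ J φ x

/-- Assumption A, stated for a family `νhat` (the parts of the Lévy measures near the origin):
Lipschitz continuity in the transport metric `d_{𝕃_p}`. -/
def AssumptionA (O : Set (Euc d)) (p : ℝ) (νhat : Euc d → A → B → Measure (Euc d)) : Prop :=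
  ∃ C : ℝ, 0 ≤ C ∧ ∀ x ∈ O, ∀ y ∈ O, ∀ (α : A) (β : B),
    dLp p (νhat x α β) (νhat y α β) ≤ C * ‖x - y‖

/-- Assumption A1: `s`-Hölder continuity in the transport metric `d_{𝕃_p}`. -/
def AssumptionA1 (O : Set (Euc d)) (p s : ℝ) (νhat : Euc d → A → B → Measure (Euc d)) : Prop :=
  ∃ C : ℝ, 0 < C ∧ ∀ x ∈ O, ∀ y ∈ O, ∀ (α : A) (β : B),
    dLp p (νhat x α β) (νhat y α β) ≤ C * ‖x - y‖ ^ s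

/-- Assumption B: continuity in total variation of the tails. -/
def AssumptionB (O : Set (Euc d)) (νcheck : Euc d → A → B → Measure (Euc d)) : Prop :=
  ∃ θ : ℝ → ℝ, IsModulus θ ∧ ∀ x ∈ O, ∀ y ∈ O, ∀ (α : A) (β : B),
    dTV (νcheck x α β) (νcheck y α β) ≤ ENNReal.ofReal (θ ‖x - y‖)

/-- Assumption C: equicontinuity and uniform boundedness of `f_{αβ}`. -/
def AssumptionC (O : Set (Euc d)) (f : A → B → Euc d → ℝ) : Prop :=
  ∃ θ : ℝ → ℝ, IsModulus θ ∧ ∃ C : ℝ, 0 ≤ C ∧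
    (∀ x ∈ O, ∀ y ∈ O, ∀ (α : A) (β : B), |f α β x - f α β y| ≤ θ ‖x - y‖) ∧
    (∀ x ∈ O, ∀ (α : A) (β : B), |f α β x| ≤ C)

/-- Assumption D: `0 < λ ≤ c_{αβ} ≤ λ₁` and equicontinuity of `c_{αβ}`. -/
def AssumptionD (O : Set (Euc d)) (c : A → B → Euc d → ℝ) : Prop :=
  ∃ lam lam1 : ℝ, 0 < lam ∧ lam ≤ lam1 ∧
    (∀ x ∈ O, ∀ (α : A) (β : B), lam ≤ c α β x ∧ c α β x ≤ lam1) ∧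
    ∃ θ : ℝ → ℝ, IsModulus θ ∧
      ∀ x ∈ O, ∀ y ∈ O, ∀ (α : A) (β : B), |c α β x - c α β y| ≤ θ ‖x - y‖

/-- Assumption E: uniform integrability of the Lévy measures. -/
def AssumptionE (O : Set (Euc d)) (p : ℝ) (μf : Euc d → A → B → Measure (Euc d)) : Prop :=
  (∃ θ : ℝ → ℝ, IsModulus θ ∧ ∀ r : ℝ, 0 < r → ∀ x ∈ O, ∀ (α : A) (β : B),
      ∫⁻ z in ball (0 : Euc d) r, ENNReal.ofReal (‖z‖ ^ p) ∂(μf x α β) ≤ ENNReal.ofReal (θ r)) ∧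
  (∃ Λ : ℝ, 0 ≤ Λ ∧ ∀ x ∈ O, ∀ (α : A) (β : B),
      ∫⁻ z, ENNReal.ofReal (min 1 (‖z‖ ^ p)) ∂(μf x α β) ≤ ENNReal.ofReal Λ)

/-- The smooth approximation `ψ_κ(x) = (κ + |x|²)^{p/2} - κ^{p/2}` of `|x|^p`. -/
def psiK (p κ : ℝ) (x : Euc d) : ℝ := (κ + ‖x‖ ^ 2) ^ (p / 2) - κ ^ (p / 2)

/-- `u` is pointwise-`C^{1,1}` at `x₀`. -/
def PointwiseC11 (u : Euc d → ℝ) (x₀ : Euc d) : Prop :=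
  DifferentiableAt ℝ u x₀ ∧ ∃ C : ℝ, 0 < C ∧ ∀ᶠ x in nhds x₀,
    |u x - u x₀ - fderiv ℝ u x₀ (x - x₀)| ≤ C * ‖x - x₀‖ ^ 2

/-- Sup-convolution `u^δ`. -/
def supConv (δ : ℝ) (u : Euc d → ℝ) (x : Euc d) : ℝ :=
  ⨆ y : Euc d, (u y - ‖x - y‖ ^ 2 / δ)

/-- Inf-convolution `v_δ`. -/
def infConv (δ : ℝ) (v : Euc d → ℝ) (x : Euc d) : ℝ :=
  ⨅ y : Euc d, (v y + ‖x - y‖ ^ 2 / δ)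

/-- `(φ,ψ) ∈ Adm^p`, the admissible pairs for the dual problem. -/
def AdmPair (p : ℝ) (μ₁ μ₂ : Measure (Euc d)) (φ ψ : Euc d → ℝ) : Prop :=
  Integrable φ μ₁ ∧ Integrable ψ μ₂ ∧
  UpperSemicontinuous φ ∧ UpperSemicontinuous ψ ∧
  φ 0 = 0 ∧ ψ 0 = 0 ∧ ∀ x y : Euc d, φ x + ψ y ≤ ‖x - y‖ ^ p

/-- Tangent-line bound for the regularised power `(κ + ‖·‖²)^{p/2}`. -/
lemma regularized_rpow_taylor {E : Type*} [NormedAddCommGroup E] [InnerProductSpace ℝ E]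
    {p κ : ℝ} (hp1 : 1 < p) (hp2 : p ≤ 2) (hκ : 0 < κ) (h k : E) :
    (κ + ‖h + k‖ ^ 2) ^ (p / 2) - (κ + ‖h‖ ^ 2) ^ (p / 2)
      - p * (κ + ‖h‖ ^ 2) ^ (p / 2 - 1) * inner ℝ h k ≤ 5 * ‖k‖ ^ p := by
  have ha : 0 < κ + ‖h‖ ^ 2 := by positivity
  have hb : 0 < κ + ‖h + k‖ ^ 2 := by positivity
  have hsq : ‖h + k‖ ^ 2 = ‖h‖ ^ 2 + 2 * inner ℝ h k + ‖k‖ ^ 2 := norm_add_sq_real h k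
  have hsplit : (κ + ‖h‖ ^ 2) ^ (p / 2) = (κ + ‖h‖ ^ 2) ^ (p / 2 - 1) * (κ + ‖h‖ ^ 2) := by
    rw [Real.rpow_sub_one ha.ne']; field_simp
  have hpow : ∀ t : ℝ, 0 ≤ t → (t ^ 2) ^ (p / 2) = t ^ p := fun t ht => by
    rw [← Real.rpow_natCast, ← Real.rpow_mul ht]; congr 1; push_cast; ring
  set a := κ + ‖h‖ ^ 2 with ha_def
  rcases eq_or_ne k 0 with rfl | hk
  · simp [Real.zero_rpow (by linarith : p ≠ 0), a]
  have hk0 : 0 < ‖k‖ := norm_pos_iff.mpr hk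
  rcases le_or_gt ‖k‖ ‖h‖ with hkh | hkh
  · have hbern := rpow_one_add_le_one_add_mul_self
      (s := (2 * inner ℝ h k + ‖k‖ ^ 2) / a) (p := p / 2)
      (by rw [le_div_iff₀ ha]; nlinarith [sq_nonneg ‖h + k‖]) (by linarith) (by linarith)
    have hba : κ + ‖h + k‖ ^ 2 = a * (1 + (2 * inner ℝ h k + ‖k‖ ^ 2) / a) := by
      field_simp; rw [hsq, ha_def]; ring
    have h1 : (κ + ‖h + k‖ ^ 2) ^ (p / 2) ≤
        a ^ (p / 2) * (1 + p / 2 * ((2 * inner ℝ h k + ‖k‖ ^ 2) / a)) := by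
      rw [hba, Real.mul_rpow ha.le]
      · gcongr
      · rw [hba] at hb
        exact (pos_of_mul_pos_right hb ha.le).le
    have h2 : a ^ (p / 2) * (1 + p / 2 * ((2 * inner ℝ h k + ‖k‖ ^ 2) / a)) =
        a ^ (p / 2) + p * a ^ (p / 2 - 1) * inner ℝ h k + p / 2 * (a ^ (p / 2 - 1) * ‖k‖ ^ 2) := by
      rw [hsplit]; field_simp; ring
    have h3 : a ^ (p / 2 - 1) * ‖k‖ ^ 2 ≤ ‖k‖ ^ p := by
      have : a ^ (p / 2 - 1) ≤ (‖k‖ ^ 2) ^ (p / 2 - 1) :=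
        Real.rpow_le_rpow_of_nonpos (by positivity) (by nlinarith) (by linarith)
      calc a ^ (p / 2 - 1) * ‖k‖ ^ 2 ≤ (‖k‖ ^ 2) ^ (p / 2 - 1) * ‖k‖ ^ 2 := by gcongr
        _ = ‖k‖ ^ p := by
          rw [Real.rpow_sub_one (by positivity), hpow _ hk0.le]; field_simp
    have : 0 < ‖k‖ ^ p := by positivity
    nlinarith
  · have h1 : (κ + ‖h + k‖ ^ 2) ^ (p / 2) ≤ a ^ (p / 2) + 3 * ‖k‖ ^ p := by
      have hle : κ + ‖h + k‖ ^ 2 ≤ a + 3 * ‖k‖ ^ 2 := by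
        have := real_inner_le_norm h k
        have h0 := norm_nonneg h
        rw [hsq, ha_def]; nlinarith
      calc (κ + ‖h + k‖ ^ 2) ^ (p / 2) ≤ (a + 3 * ‖k‖ ^ 2) ^ (p / 2) := by gcongr
        _ ≤ a ^ (p / 2) + (3 * ‖k‖ ^ 2) ^ (p / 2) :=
          Real.rpow_add_le_add_rpow ha.le (by positivity) (by linarith) (by linarith)
        _ ≤ a ^ (p / 2) + 3 * ‖k‖ ^ p := by
          rw [Real.mul_rpow (by norm_num) (by positivity), hpow _ hk0.le]
          gcongr
          calc (3 : ℝ) ^ (p / 2) ≤ 3 ^ (1 : ℝ) :=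
                Real.rpow_le_rpow_of_exponent_le (by norm_num) (by linarith)
            _ = 3 := by norm_num
    have h2 : -(p * a ^ (p / 2 - 1) * inner ℝ h k) ≤ 2 * ‖k‖ ^ p := by
      rcases eq_or_ne h 0 with rfl | hh
      · simp only [inner_zero_left, mul_zero, neg_zero]; positivity
      have hh0 : 0 < ‖h‖ := norm_pos_iff.mpr hh
      have hin : -inner ℝ h k ≤ ‖h‖ * ‖k‖ := by
        have := real_inner_le_norm (-h) k
        simpa using this
      have hae : a ^ (p / 2 - 1) ≤ (‖h‖ ^ 2) ^ (p / 2 - 1) :=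
        Real.rpow_le_rpow_of_nonpos (by positivity) (by rw [ha_def]; linarith) (by linarith)
      have hhp : (‖h‖ ^ 2) ^ (p / 2 - 1) * ‖h‖ = ‖h‖ ^ (p - 1) := by
        rw [Real.rpow_sub_one (by positivity), hpow _ hh0.le, Real.rpow_sub_one hh0.ne']
        field_simp
      have hkp : ‖k‖ ^ (p - 1) * ‖k‖ = ‖k‖ ^ p := by
        rw [Real.rpow_sub_one hk0.ne']; field_simp
      calc -(p * a ^ (p / 2 - 1) * inner ℝ h k) = p * a ^ (p / 2 - 1) * (-inner ℝ h k) := by ring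
        _ ≤ p * a ^ (p / 2 - 1) * (‖h‖ * ‖k‖) := by gcongr
        _ ≤ p * (‖h‖ ^ 2) ^ (p / 2 - 1) * (‖h‖ * ‖k‖) := by gcongr
        _ = p * ‖h‖ ^ (p - 1) * ‖k‖ := by rw [← hhp]; ring
        _ ≤ 2 * ‖k‖ ^ (p - 1) * ‖k‖ := by gcongr
        _ = 2 * ‖k‖ ^ p := by rw [mul_assoc, hkp]
    linarith

/-- A smooth penalisation of `x = y` of order `p`: it is semiconcave of order `p` with constant
`L`, as large as prescribed away from the origin, and `L ‖h‖^{p-1}` is controlled by its gradient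
up to a prescribed error. -/
lemma exists_penalty {E : Type*} [NormedAddCommGroup E] [InnerProductSpace ℝ E]
    {p ρ K σ : ℝ} (hp1 : 1 < p) (hp2 : p ≤ 2) (hρ : 0 < ρ) (hK : 0 < K) (hσ : 0 < σ) :
    ∃ (Ψ : E → ℝ) (G : E → E) (L : ℝ), 0 ≤ L ∧ ContDiff ℝ 2 Ψ ∧ Ψ 0 = 0 ∧ (∀ h, 0 ≤ Ψ h) ∧
      (∀ h, HasFDerivAt Ψ (innerSL ℝ (G h)) h) ∧
      (∀ h k, Ψ (h + k) - Ψ h - inner ℝ (G h) k ≤ L * ‖k‖ ^ p) ∧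
      (∀ h, ρ ≤ ‖h‖ → K * (1 + ‖h‖) ≤ Ψ h) ∧
      (∀ h, L * ‖h‖ ^ (p - 1) ≤ 10 * (‖G h‖ + σ)) := by
  set δ : ℝ := ρ ^ (p - 1) / (2 * K * (1 / ρ + 1)) with hδ_def
  have hδ : 0 < δ := by positivity
  set κ : ℝ := min ((σ * δ) ^ (2 / (p - 1))) ((ρ ^ p / 2) ^ (2 / p)) with hκ_def
  have hp0 : 0 < p - 1 := by linarith
  have hκ : 0 < κ := by positivity
  have hκ1 : κ ^ ((p - 1) / 2) ≤ σ * δ := by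
    calc κ ^ ((p - 1) / 2) ≤ ((σ * δ) ^ (2 / (p - 1))) ^ ((p - 1) / 2) := by
          gcongr; exact min_le_left _ _
      _ = σ * δ := by
          rw [← Real.rpow_mul (by positivity)]
          rw [show 2 / (p - 1) * ((p - 1) / 2) = 1 by field_simp, Real.rpow_one]
  have hκ2 : κ ^ (p / 2) ≤ ρ ^ p / 2 := by
    calc κ ^ (p / 2) ≤ ((ρ ^ p / 2) ^ (2 / p)) ^ (p / 2) := by
          gcongr; exact min_le_right _ _
      _ = ρ ^ p / 2 := by
          rw [← Real.rpow_mul (by positivity)]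
          rw [show 2 / p * (p / 2) = 1 by field_simp, Real.rpow_one]
  have hpow : ∀ t : ℝ, 0 ≤ t → (t ^ 2) ^ (p / 2) = t ^ p := fun t ht => by
    rw [← Real.rpow_natCast, ← Real.rpow_mul ht]; congr 1; push_cast; ring
  have hpos : ∀ h : E, 0 < κ + ‖h‖ ^ 2 := fun h => by positivity
  refine ⟨fun h => δ⁻¹ * ((κ + ‖h‖ ^ 2) ^ (p / 2) - κ ^ (p / 2)),
    fun h => (δ⁻¹ * (p * (κ + ‖h‖ ^ 2) ^ (p / 2 - 1))) • h, 5 * δ⁻¹, by positivity, ?_, ?_, ?_, ?_,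
    ?_, ?_, ?_⟩
  · refine contDiff_const.mul (ContDiff.sub ?_ contDiff_const)
    exact (contDiff_const.add (contDiff_norm_sq ℝ)).rpow_const_of_ne fun h => (hpos h).ne'
  · simp
  · intro h
    have : κ ^ (p / 2) ≤ (κ + ‖h‖ ^ 2) ^ (p / 2) := by
      gcongr; nlinarith [norm_nonneg h]
    exact mul_nonneg (by positivity) (by linarith)
  · intro h
    have h1 : HasFDerivAt (fun h : E => κ + ‖h‖ ^ 2) (2 • innerSL ℝ h) h :=
      ((hasStrictFDerivAt_norm_sq h).hasFDerivAt).const_add κ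
    have h2 := ((h1.rpow_const (p := p / 2) (Or.inl (hpos h).ne')).sub_const
      (κ ^ (p / 2))).const_mul δ⁻¹
    refine h2.congr_fderiv ?_
    ext k
    simp only [_root_.smul_apply, innerSL_apply_apply, inner_smul_left, smul_eq_mul,
      nsmul_eq_mul, conj_trivial]
    push_cast
    ring
  · intro h k
    have := regularized_rpow_taylor hp1 hp2 hκ h k
    have h1 := mul_le_mul_of_nonneg_left this (inv_pos.mpr hδ).le
    simp only [inner_smul_left, conj_trivial]
    linarith
  · intro h hh
    have hh0 : 0 < ‖h‖ := hρ.trans_le hh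
    have h1 : ‖h‖ ^ p ≤ (κ + ‖h‖ ^ 2) ^ (p / 2) := by
      rw [← hpow _ hh0.le]; gcongr; linarith
    have h2 : ρ ^ p ≤ ‖h‖ ^ p := by gcongr
    have h3 : ρ ^ (p - 1) * ‖h‖ ≤ ‖h‖ ^ p := by
      calc ρ ^ (p - 1) * ‖h‖ ≤ ‖h‖ ^ (p - 1) * ‖h‖ := by gcongr
        _ = ‖h‖ ^ p := by rw [Real.rpow_sub_one hh0.ne']; field_simp
    have h4 : K * (1 + ‖h‖) ≤ K * ((1 / ρ + 1) * ‖h‖) := by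
      gcongr
      have : 1 ≤ ‖h‖ / ρ := by rwa [one_le_div hρ]
      calc 1 + ‖h‖ ≤ ‖h‖ / ρ + ‖h‖ := by linarith
        _ = _ := by ring
    refine h4.trans ?_
    change _ ≤ δ⁻¹ * ((κ + ‖h‖ ^ 2) ^ (p / 2) - κ ^ (p / 2))
    rw [← div_eq_inv_mul, le_div_iff₀ hδ]
    calc K * ((1 / ρ + 1) * ‖h‖) * δ = ρ ^ (p - 1) * ‖h‖ / 2 := by
          rw [hδ_def]; field_simp
      _ ≤ _ := by linarith
  · intro h
    have hG : ‖(δ⁻¹ * (p * (κ + ‖h‖ ^ 2) ^ (p / 2 - 1))) • h‖ =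
        δ⁻¹ * (p * (κ + ‖h‖ ^ 2) ^ (p / 2 - 1)) * ‖h‖ := by
      rw [norm_smul, Real.norm_of_nonneg]
      have := hpos h
      positivity
    rw [hG]
    rcases le_or_gt κ (‖h‖ ^ 2) with hle | hlt
    · have hh0 : 0 < ‖h‖ := by
        rcases (norm_nonneg h).eq_or_lt with h0 | h0
        · rw [← h0] at hle; norm_num at hle; linarith
        · exact h0
      have h1 : (2 * ‖h‖ ^ 2) ^ (p / 2 - 1) ≤ (κ + ‖h‖ ^ 2) ^ (p / 2 - 1) :=
        Real.rpow_le_rpow_of_nonpos (hpos h) (by linarith) (by linarith)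
      have h2 : (2 * ‖h‖ ^ 2) ^ (p / 2 - 1) * ‖h‖ = 2 ^ (p / 2 - 1) * ‖h‖ ^ (p - 1) := by
        rw [Real.mul_rpow (by norm_num) (by positivity), Real.rpow_sub_one (x := ‖h‖ ^ 2)
          (by positivity), hpow _ hh0.le, Real.rpow_sub_one hh0.ne']
        field_simp
      have h3 : (1 / 2 : ℝ) ≤ 2 ^ (p / 2 - 1) := by
        calc (1 / 2 : ℝ) = 2 ^ (-1 : ℝ) := by rw [Real.rpow_neg_one]; norm_num
          _ ≤ _ := Real.rpow_le_rpow_of_exponent_le (by norm_num) (by linarith)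
      have h4 : 1 / 2 * ‖h‖ ^ (p - 1) ≤ p * ((κ + ‖h‖ ^ 2) ^ (p / 2 - 1) * ‖h‖) := by
        calc 1 / 2 * ‖h‖ ^ (p - 1) ≤ 2 ^ (p / 2 - 1) * ‖h‖ ^ (p - 1) := by gcongr
          _ = 1 * ((2 * ‖h‖ ^ 2) ^ (p / 2 - 1) * ‖h‖) := by rw [h2, one_mul]
          _ ≤ p * ((κ + ‖h‖ ^ 2) ^ (p / 2 - 1) * ‖h‖) := by gcongr
      have h5 := mul_le_mul_of_nonneg_left h4 (inv_pos.mpr hδ).le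
      linarith
    · have h1 : ‖h‖ ^ (p - 1) ≤ σ * δ := by
        refine le_trans ?_ hκ1
        calc ‖h‖ ^ (p - 1) = (‖h‖ ^ 2) ^ ((p - 1) / 2) := by
              rw [← Real.rpow_natCast, ← Real.rpow_mul (norm_nonneg h)]
              congr 1; push_cast; ring
          _ ≤ _ := by gcongr
      have h2 : 5 * δ⁻¹ * ‖h‖ ^ (p - 1) ≤ 5 * σ := by
        calc 5 * δ⁻¹ * ‖h‖ ^ (p - 1) ≤ 5 * δ⁻¹ * (σ * δ) := by gcongr
          _ = 5 * σ := by field_simp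
      have h3 : 0 ≤ δ⁻¹ * (p * (κ + ‖h‖ ^ 2) ^ (p / 2 - 1)) * ‖h‖ := by
        have := hpos h
        positivity
      linarith

/-- Integrals of a bounded function against two finite measures differ by at most a multiple of
their total variation distance. -/
lemma integral_sub_le_of_dTV_le {X : Type*} [MeasurableSpace X] {μ ν : Measure X}
    [IsFiniteMeasure μ] [IsFiniteMeasure ν] {h : X → ℝ} {H D : ℝ} (hm : Measurable h)
    (hH : ∀ x, |h x| ≤ H) (hH0 : 0 ≤ H) (hD : 0 ≤ D) (hTV : dTV μ ν ≤ ENNReal.ofReal D) :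
    ∫ x, h x ∂μ - ∫ x, h x ∂ν ≤ 3 * H * D := by
  have hset : ∀ s, MeasurableSet s → μ s ≤ ν s + ENNReal.ofReal D := fun s hs => by
    rw [← tsub_le_iff_left]
    exact (le_iSup₂ (f := fun s (_ : MeasurableSet s) => μ s - ν s) s hs).trans
      (le_self_add.trans hTV)
  have hset' : ∀ s, MeasurableSet s → ν s ≤ μ s + ENNReal.ofReal D := fun s hs => by
    rw [← tsub_le_iff_left]
    exact (le_iSup₂ (f := fun s (_ : MeasurableSet s) => ν s - μ s) s hs).trans
      (le_add_self.trans hTV)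
  have hint : ∀ m : Measure X, IsFiniteMeasure m → Integrable h m := fun m _ =>
    Integrable.of_bound hm.aestronglyMeasurable H (Eventually.of_forall hH)
  have hgm : Measurable fun x => h x + H := hm.add_const H
  have hg0 : ∀ x, 0 ≤ h x + H := fun x => by linarith [(abs_le.mp (hH x)).1]
  have hlin : ∫⁻ x, ENNReal.ofReal (h x + H) ∂μ ≤
      ∫⁻ x, ENNReal.ofReal (h x + H) ∂ν + ENNReal.ofReal D * ENNReal.ofReal (2 * H) := by
    rw [lintegral_eq_lintegral_meas_lt μ (Eventually.of_forall hg0) hgm.aemeasurable,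
      lintegral_eq_lintegral_meas_lt ν (Eventually.of_forall hg0) hgm.aemeasurable]
    have hmeas : Measurable fun t : ℝ =>
        (Iio (2 * H)).indicator (fun _ => ENNReal.ofReal D) t :=
      measurable_const.indicator measurableSet_Iio
    calc ∫⁻ t in Ioi 0, μ {a | t < h a + H}
        ≤ ∫⁻ t in Ioi 0, (ν {a | t < h a + H} +
            (Iio (2 * H)).indicator (fun _ => ENNReal.ofReal D) t) := by
          refine lintegral_mono fun t => ?_
          by_cases ht : t < 2 * H
          · simpa [ht] using hset _ (measurableSet_lt measurable_const hgm)
          · have : {a | t < h a + H} = ∅ := by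
              ext a
              simp only [mem_ofPred_eq, mem_empty_iff_false, iff_false, not_lt]
              linarith [(abs_le.mp (hH a)).2]
            simp [this]
      _ = (∫⁻ t in Ioi 0, ν {a | t < h a + H}) + ENNReal.ofReal D * ENNReal.ofReal (2 * H) := by
          rw [lintegral_add_right _ hmeas, lintegral_indicator measurableSet_Iio,
            setLIntegral_const, Measure.restrict_apply measurableSet_Iio, inter_comm, Ioi_inter_Iio,
            Real.volume_Ioo, sub_zero]
  have hfin : ∀ m : Measure X, IsFiniteMeasure m → ∫⁻ x, ENNReal.ofReal (h x + H) ∂m ≠ ⊤ :=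
    fun m _ => ((hint m ‹_›).add (integrable_const H)).lintegral_lt_top.ne
  have hreal := ENNReal.toReal_mono (by finiteness [hfin ν ‹_›]) hlin
  rw [ENNReal.toReal_add (hfin ν ‹_›) (by finiteness), ENNReal.toReal_mul,
    ENNReal.toReal_ofReal hD, ENNReal.toReal_ofReal (by linarith),
    ← integral_eq_lintegral_of_nonneg_ae (Eventually.of_forall hg0) hgm.aestronglyMeasurable,
    ← integral_eq_lintegral_of_nonneg_ae (Eventually.of_forall hg0) hgm.aestronglyMeasurable,
    integral_add (hint μ ‹_›) (integrable_const H), integral_add (hint ν ‹_›) (integrable_const H),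
    integral_const, integral_const, smul_eq_mul, smul_eq_mul] at hreal
  have huniv := ENNReal.toReal_mono (by finiteness) (hset' univ MeasurableSet.univ)
  rw [ENNReal.toReal_add (by finiteness) (by finiteness), ENNReal.toReal_ofReal hD] at huniv
  have huniv' : ν.real univ ≤ μ.real univ + D := huniv
  nlinarith

/-- The transport cost between measures with finite `p`-moment is finite. -/
lemma dLpPow_ne_top {p : ℝ} {μ₁ μ₂ : Measure (Euc d)} (h₁ : μ₁ {0} = 0)
    (h₂ : μ₂ {0} = 0) (hm₁ : ∫⁻ z, ENNReal.ofReal (‖z‖ ^ p) ∂μ₁ ≠ ⊤)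
    (hm₂ : ∫⁻ z, ENNReal.ofReal (‖z‖ ^ p) ∂μ₂ ≠ ⊤) : dLpPow p μ₁ μ₂ ≠ ⊤ := by
  have hf₁ : Measurable fun z : Euc d => (z, (0 : Euc d)) := measurable_id.prodMk measurable_const
  have hf₂ : Measurable fun z : Euc d => ((0 : Euc d), z) := measurable_const.prodMk measurable_id
  have hcost : Measurable fun q : Euc d × Euc d => ENNReal.ofReal (‖q.1 - q.2‖ ^ p) := by
    fun_prop
  set γ : Measure (Euc d × Euc d) := μ₁.map (fun z => (z, 0)) + μ₂.map (fun z => (0, z)) with hγ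
  have hrestr : ∀ μ : Measure (Euc d), μ {0} = 0 → μ.restrict {(0 : Euc d)}ᶜ = μ := fun μ hμ =>
    Measure.restrict_eq_self_of_ae_mem (by
      rw [ae_iff]; simpa using hμ)
  have hzero : ∀ μ : Measure (Euc d),
      (μ.map fun _ : Euc d => (0 : Euc d)).restrict {(0 : Euc d)}ᶜ = 0 := fun μ => by
    rw [Measure.restrict_eq_zero, Measure.map_apply measurable_const
      (measurableSet_singleton _).compl]
    simp
  have hadm : γ ∈ AdmPlan μ₁ μ₂ := by
    refine ⟨?_, ?_, ?_⟩
    · rw [hγ, Measure.add_apply, Measure.map_apply hf₁ (measurableSet_singleton _),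
        Measure.map_apply hf₂ (measurableSet_singleton _)]
      have e₁ : (fun z : Euc d => (z, (0 : Euc d))) ⁻¹' {(0, 0)} = {0} := by ext; simp
      have e₂ : (fun z : Euc d => ((0 : Euc d), z)) ⁻¹' {(0, 0)} = {0} := by ext; simp
      rw [e₁, e₂, h₁, h₂, add_zero]
    · rw [hγ, Measure.map_add _ _ measurable_fst, Measure.map_map measurable_fst hf₁,
        Measure.map_map measurable_fst hf₂, Measure.restrict_add]
      have := hzero μ₂
      simp only [Function.comp_def] at this ⊢
      rw [this, add_zero, show (fun x : Euc d => x) = id from rfl, Measure.map_id, hrestr μ₁ h₁]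
    · rw [hγ, Measure.map_add _ _ measurable_snd, Measure.map_map measurable_snd hf₁,
        Measure.map_map measurable_snd hf₂, Measure.restrict_add]
      have := hzero μ₁
      simp only [Function.comp_def] at this ⊢
      rw [this, zero_add, show (fun x : Euc d => x) = id from rfl, Measure.map_id, hrestr μ₂ h₂]
  refine ne_top_of_le_ne_top ?_ (iInf₂_le γ hadm)
  rw [Jp, hγ, lintegral_add_measure, lintegral_map hcost hf₁, lintegral_map hcost hf₂]
  simpa using ⟨hm₁, hm₂⟩

/-- A pointwise inequality on pairs `(z, w)` integrates to an inequality between integrals up to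
the transport distance. -/
lemma integral_sub_le_of_dLp_le {p : ℝ} (hp : 0 < p) {μ₁ μ₂ : Measure (Euc d)} {s : Set (Euc d)}
    (hs : (0 : Euc d) ∈ s) (hs₁ : ∀ᵐ z ∂μ₁, z ∈ s) (hs₂ : ∀ᵐ z ∂μ₂, z ∈ s)
    (hfin : dLpPow p μ₁ μ₂ ≠ ⊤) {a b e : Euc d → ℝ} (hae : Measurable a) (hbe : Measurable b)
    (hee : Measurable e) (ha0 : a 0 = 0) (hb0 : b 0 = 0) (he0 : e 0 = 0)
    (ha : Integrable a μ₁) (hb : Integrable b μ₂) (he₁ : Integrable e μ₁) (he₂ : Integrable e μ₂)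
    {S D : ℝ} (hS : 0 ≤ S) (hD : dLp p μ₁ μ₂ ≤ D)
    (hle : ∀ z ∈ s, ∀ w ∈ s, a z - b w ≤ S * ‖z - w‖ ^ p + e z + e w) :
    ∫ z, a z ∂μ₁ - ∫ z, b z ∂μ₂ ≤ S * D ^ p + ∫ z, e z ∂μ₁ + ∫ z, e z ∂μ₂ := by
  have hpull : ∀ (γ : Measure (Euc d × Euc d)) (π : Euc d × Euc d → Euc d) (μ : Measure (Euc d)),
      Measurable π → (γ.map π).restrict {(0 : Euc d)}ᶜ = μ → ∀ g : Euc d → ℝ, Measurable g →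
      g 0 = 0 → Integrable g μ → Integrable (fun q => g (π q)) γ ∧
        ∫ q, g (π q) ∂γ = ∫ z, g z ∂μ := by
    intro γ π μ hπ hμ g hgm hg0 hgi
    have hsupp : Function.support g ⊆ {(0 : Euc d)}ᶜ := fun z hz h0 => hz (by
      rw [mem_singleton_iff.mp h0, hg0])
    have hi : Integrable g (γ.map π) := by
      rw [← hμ] at hgi
      exact (integrableOn_iff_integrable_of_support_subset hsupp).mp hgi
    refine ⟨hi.comp_measurable hπ, ?_⟩
    rw [← integral_map hπ.aemeasurable hgm.aestronglyMeasurable, ← hμ,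
      setIntegral_eq_integral_of_forall_compl_eq_zero]
    intro z hz
    simpa [hg0] using congrArg g (not_not.mp hz)
  have hmem : ∀ (γ : Measure (Euc d × Euc d)) (π : Euc d × Euc d → Euc d) (μ : Measure (Euc d)),
      Measurable π → (γ.map π).restrict {(0 : Euc d)}ᶜ = μ → (∀ᵐ z ∂μ, z ∈ s) →
      ∀ᵐ q ∂γ, π q ∈ s := by
    intro γ π μ hπ hμ hsμ
    rw [← hμ, ae_restrict_iff' (measurableSet_singleton _).compl] at hsμ
    filter_upwards [ae_of_ae_map hπ.aemeasurable hsμ] with q hq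
    by_cases h0 : π q = 0
    · rwa [h0]
    · exact hq h0
  have hplan : ∀ γ ∈ AdmPlan μ₁ μ₂, Jp p γ ≠ ⊤ → ∫ z, a z ∂μ₁ - ∫ z, b z ∂μ₂ ≤
      S * (Jp p γ).toReal + ∫ z, e z ∂μ₁ + ∫ z, e z ∂μ₂ := by
    rintro γ ⟨-, hγ₁, hγ₂⟩ hJ
    obtain ⟨ia, ea⟩ := hpull γ _ _ measurable_fst hγ₁ a hae ha0 ha
    obtain ⟨ib, eb⟩ := hpull γ _ _ measurable_snd hγ₂ b hbe hb0 hb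
    obtain ⟨ie₁, ee₁⟩ := hpull γ _ _ measurable_fst hγ₁ e hee he0 he₁
    obtain ⟨ie₂, ee₂⟩ := hpull γ _ _ measurable_snd hγ₂ e hee he0 he₂
    have hcm : Measurable fun q : Euc d × Euc d => ‖q.1 - q.2‖ ^ p := by fun_prop
    have hc0 : ∀ q : Euc d × Euc d, 0 ≤ ‖q.1 - q.2‖ ^ p := fun q => by positivity
    have ic : Integrable (fun q : Euc d × Euc d => ‖q.1 - q.2‖ ^ p) γ :=
      (lintegral_ofReal_ne_top_iff_integrable hcm.aestronglyMeasurable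
        (Eventually.of_forall hc0)).mp hJ
    have ec : (Jp p γ).toReal = ∫ q : Euc d × Euc d, ‖q.1 - q.2‖ ^ p ∂γ :=
      (integral_eq_lintegral_of_nonneg_ae (Eventually.of_forall hc0)
        hcm.aestronglyMeasurable).symm
    have ice : Integrable (fun q : Euc d × Euc d => S * ‖q.1 - q.2‖ ^ p + e q.1) γ :=
      (ic.const_mul S).add ie₁
    rw [ec, ← ea, ← eb, ← ee₁, ← ee₂, ← integral_sub ia ib, ← integral_const_mul,
      ← integral_add (ic.const_mul S) ie₁, ← integral_add ice ie₂]
    refine integral_mono_ae (ia.sub ib) (ice.add ie₂) ?_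
    filter_upwards [hmem γ _ _ measurable_fst hγ₁ hs₁, hmem γ _ _ measurable_snd hγ₂ hs₂]
      with q h₁ h₂ using hle _ h₁ _ h₂
  have hpow : (dLpPow p μ₁ μ₂).toReal ≤ D ^ p := by
    calc (dLpPow p μ₁ μ₂).toReal = dLp p μ₁ μ₂ ^ p := by
          rw [dLp, ← Real.rpow_mul ENNReal.toReal_nonneg, one_div_mul_cancel hp.ne', Real.rpow_one]
      _ ≤ D ^ p := Real.rpow_le_rpow (by unfold dLp; positivity) hD hp.le
  refine le_of_forall_pos_le_add fun ε hε => ?_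
  have hS1 : 0 < S + 1 := by linarith
  obtain ⟨γ, hγ, hJ⟩ : ∃ γ ∈ AdmPlan μ₁ μ₂,
      Jp p γ < dLpPow p μ₁ μ₂ + ENNReal.ofReal (ε / (S + 1)) := by
    have : dLpPow p μ₁ μ₂ < dLpPow p μ₁ μ₂ + ENNReal.ofReal (ε / (S + 1)) :=
      ENNReal.lt_add_right hfin (by simpa using div_pos hε hS1)
    simpa only [dLpPow, iInf_lt_iff, exists_prop] using this
  have hJt : (Jp p γ).toReal ≤ D ^ p + ε / (S + 1) := by
    have := ENNReal.toReal_mono (by finiteness) hJ.le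
    rw [ENNReal.toReal_add hfin (by finiteness), ENNReal.toReal_ofReal (by positivity)] at this
    linarith
  have hSe : S * (ε / (S + 1)) ≤ ε := by
    rw [mul_div_assoc', div_le_iff₀ hS1]; nlinarith
  have := hplan γ hγ (ne_top_of_lt hJ)
  nlinarith [mul_le_mul_of_nonneg_left hJt hS]

/-- The integrand of the Lévy operator is controlled by `min(1, ‖z‖^p)`. -/
lemma exists_levy_integrand_bound {p : ℝ} (hp0 : 0 ≤ p) (hp2 : p ≤ 2) {φ : Euc d → ℝ}
    (hφ : ContDiff ℝ 2 φ) (hb : ∃ M, ∀ x, |φ x| ≤ M) (x : Euc d) :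
    ∃ C, 0 ≤ C ∧ ∀ z, |φ (x + z) - φ x -
      (ball (0 : Euc d) 1).indicator (fun w => fderiv ℝ φ x w) z| ≤ C * min 1 (‖z‖ ^ p) := by
  obtain ⟨M, hM⟩ := hb
  have hd : ContDiff ℝ 1 (fderiv ℝ φ) := hφ.fderiv_right (by norm_num)
  obtain ⟨K, hK⟩ := (isCompact_closedBall x 1).exists_bound_of_continuousOn
    (hd.continuous_fderiv (by norm_num)).continuousOn
  have hK0 : 0 ≤ K := (norm_nonneg _).trans (hK x (mem_closedBall_self zero_le_one))
  have hM0 : 0 ≤ M := (abs_nonneg _).trans (hM x)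
  refine ⟨max K (2 * M), le_max_of_le_left hK0, fun z => ?_⟩
  by_cases hz : z ∈ ball (0 : Euc d) 1
  · have hz1 : ‖z‖ < 1 := by simpa using hz
    rw [indicator_of_mem hz]
    have hlip : ∀ w ∈ closedBall x ‖z‖, ‖fderiv ℝ φ w - fderiv ℝ φ x‖ ≤ K * ‖z‖ := by
      intro w hw
      have := (convex_closedBall x ‖z‖).norm_image_sub_le_of_norm_fderiv_le (C := K)
        (fun y _ => hd.differentiable (by norm_num) y)
        (fun y hy => hK y (closedBall_subset_closedBall hz1.le hy))
        (mem_closedBall_self (norm_nonneg z)) hw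
      refine this.trans ?_
      gcongr
      simpa [dist_eq_norm] using hw
    have h1 := (convex_closedBall x ‖z‖).norm_image_sub_le_of_norm_fderiv_le'
      (fun y _ => hφ.differentiable (by norm_num) y) hlip
      (mem_closedBall_self (norm_nonneg z)) (show x + z ∈ closedBall x ‖z‖ by simp)
    rw [add_sub_cancel_left, Real.norm_eq_abs] at h1
    have h2 : ‖z‖ * ‖z‖ ≤ ‖z‖ ^ p := by
      rw [← sq, ← Real.rpow_natCast]
      rcases (norm_nonneg z).eq_or_lt with h0 | h0
      · rw [← h0]
        simp [Real.zero_rpow_nonneg]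
      · exact Real.rpow_le_rpow_of_exponent_ge h0 hz1.le (by simpa using hp2)
    rw [min_eq_right (Real.rpow_le_one (norm_nonneg z) hz1.le hp0)]
    calc _ ≤ K * ‖z‖ * ‖z‖ := h1
      _ = K * (‖z‖ * ‖z‖) := by ring
      _ ≤ max K (2 * M) * ‖z‖ ^ p := by
        gcongr
        exact le_max_left _ _
  · have hz1 : 1 ≤ ‖z‖ := by simpa using hz
    rw [indicator_of_notMem hz, sub_zero, min_eq_left (Real.one_le_rpow hz1 hp0), mul_one]
    refine le_max_of_le_right ?_
    have h1 := abs_le.mp (hM (x + z))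
    have h2 := abs_le.mp (hM x)
    exact abs_le.mpr ⟨by linarith, by linarith⟩

lemma measurable_levy_integrand {φ : Euc d → ℝ} (hφ : Continuous φ) (x : Euc d) :
    Measurable fun z => φ (x + z) - φ x -
      (ball (0 : Euc d) 1).indicator (fun w => fderiv ℝ φ x w) z :=
  ((hφ.comp (continuous_const.add continuous_id)).measurable.sub_const _).sub
    ((fderiv ℝ φ x).continuous.measurable.indicator measurableSet_ball)

lemma integrable_min_one_rpow {p Λ : ℝ} {μ : Measure (Euc d)}
    (hμ : ∫⁻ z, ENNReal.ofReal (min 1 (‖z‖ ^ p)) ∂μ ≤ ENNReal.ofReal Λ) :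
    Integrable (fun z : Euc d => min 1 (‖z‖ ^ p)) μ :=
  (lintegral_ofReal_ne_top_iff_integrable
    (Measurable.aestronglyMeasurable (by fun_prop))
    (Eventually.of_forall fun z => by positivity)).mp (ne_top_of_le_ne_top (by finiteness) hμ)

lemma integral_min_one_rpow_le {p Λ : ℝ} (hΛ : 0 ≤ Λ) {μ : Measure (Euc d)}
    (hμ : ∫⁻ z, ENNReal.ofReal (min 1 (‖z‖ ^ p)) ∂μ ≤ ENNReal.ofReal Λ) :
    ∫ z : Euc d, min 1 (‖z‖ ^ p) ∂μ ≤ Λ := by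
  rw [integral_eq_lintegral_of_nonneg_ae (Eventually.of_forall fun z => by positivity)
    (Measurable.aestronglyMeasurable (by fun_prop))]
  exact ENNReal.toReal_le_of_le_ofReal hΛ hμ

lemma integrable_levy_integrand {p Λ : ℝ} (hp0 : 0 ≤ p) (hp2 : p ≤ 2) {φ : Euc d → ℝ}
    (hφ : ContDiff ℝ 2 φ) (hb : ∃ M, ∀ x, |φ x| ≤ M) (x : Euc d) {μ : Measure (Euc d)}
    (hμ : ∫⁻ z, ENNReal.ofReal (min 1 (‖z‖ ^ p)) ∂μ ≤ ENNReal.ofReal Λ) :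
    Integrable (fun z => φ (x + z) - φ x -
      (ball (0 : Euc d) 1).indicator (fun w => fderiv ℝ φ x w) z) μ := by
  obtain ⟨C, -, hC⟩ := exists_levy_integrand_bound hp0 hp2 hφ hb x
  exact ((integrable_min_one_rpow hμ).const_mul C).mono'
    (measurable_levy_integrand hφ.continuous x).aestronglyMeasurable
    (Eventually.of_forall hC)

lemma exists_abs_Lop_le {p Λ : ℝ} (hp0 : 0 ≤ p) (hp2 : p ≤ 2) (hΛ : 0 ≤ Λ) {φ : Euc d → ℝ}
    (hφ : ContDiff ℝ 2 φ) (hb : ∃ M, ∀ x, |φ x| ≤ M) (x : Euc d) :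
    ∃ C, ∀ μ : Measure (Euc d),
      ∫⁻ z, ENNReal.ofReal (min 1 (‖z‖ ^ p)) ∂μ ≤ ENNReal.ofReal Λ → |Lop μ φ x| ≤ C := by
  obtain ⟨C, hC0, hC⟩ := exists_levy_integrand_bound hp0 hp2 hφ hb x
  refine ⟨C * Λ, fun μ hμ => ?_⟩
  rw [Lop, ← Real.norm_eq_abs]
  calc _ ≤ ∫ z, C * min 1 (‖z‖ ^ p) ∂μ :=
        norm_integral_le_of_norm_le ((integrable_min_one_rpow hμ).const_mul C)
          (Eventually.of_forall hC)
    _ ≤ C * Λ := by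
        rw [integral_const_mul]
        exact mul_le_mul_of_nonneg_left (integral_min_one_rpow_le hΛ hμ) hC0

/-- Selection of nearly optimal indices in two sup-inf expressions. -/
lemma exists_index_of_iSup_iInf [Nonempty A] [Nonempty B] {F G : A → B → ℝ} {R : ℝ}
    (hF : ∀ α β, |F α β| ≤ R) (hG : ∀ α β, |G α β| ≤ R) (hF0 : ⨆ α, ⨅ β, F α β ≤ 0)
    (hG0 : 0 ≤ ⨆ α, ⨅ β, G α β) {τ : ℝ} (hτ : 0 < τ) :
    ∃ α β, F α β ≤ τ ∧ -τ ≤ G α β := by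
  have hbelow : ∀ H : A → B → ℝ, (∀ α β, |H α β| ≤ R) → ∀ α, BddBelow (range (H α)) :=
    fun H hH α => ⟨-R, by rintro _ ⟨β, rfl⟩; exact (abs_le.mp (hH α β)).1⟩
  have habove : BddAbove (range fun α => ⨅ β, F α β) := by
    refine ⟨R, ?_⟩
    rintro _ ⟨α, rfl⟩
    obtain ⟨β⟩ := ‹Nonempty B›
    exact (ciInf_le (hbelow F hF α) β).trans (abs_le.mp (hF α β)).2
  obtain ⟨α, hα⟩ := exists_lt_of_lt_ciSup (show -τ < ⨆ α, ⨅ β, G α β by linarith)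
  have hFα : ⨅ β, F α β < τ := ((le_ciSup habove α).trans hF0).trans_lt hτ
  obtain ⟨β, hβ⟩ := exists_lt_of_ciInf_lt hFα
  exact ⟨α, β, hβ.le, hα.le.trans (ciInf_le (hbelow G hG α) β)⟩

/-- A test function touching `u` from above at `x` can be replaced by a bounded one which is close
to `u` away from `x`. -/
lemma exists_test_function {u φ : Euc d → ℝ} (hu : IsBUC u) (hφ : ContDiff ℝ 2 φ) {x : Euc d}
    (hle : ∀ y, u y ≤ φ y) (hx : u x = φ x) {r η : ℝ} (hr : 0 < r) (hη : 0 < η) :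
    ∃ Φ : Euc d → ℝ, ContDiff ℝ 2 Φ ∧ (∃ M, ∀ y, |Φ y| ≤ M) ∧ (∀ y, u y ≤ Φ y) ∧
      Φ x = u x ∧ fderiv ℝ Φ x = fderiv ℝ φ x ∧ (∀ z, ‖z‖ < r → Φ (x + z) ≤ φ (x + z)) ∧
      (∀ z, Φ (x + z) ≤ φ (x + z) + η) ∧ (∀ z, 2 * r ≤ ‖z‖ → Φ (x + z) ≤ u (x + z) + η) := by
  obtain ⟨⟨M, hM⟩, huc⟩ := hu
  obtain ⟨g, hg, hgd⟩ := huc.exists_contDiff_dist_le (half_pos hη)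
  have hgd' : ∀ y, u y ≤ g y + η / 2 ∧ g y + η / 2 ≤ u y + η := fun y => by
    have := abs_lt.mp (by simpa [Real.dist_eq] using hgd y)
    constructor <;> linarith
  let χ : ContDiffBump x := ⟨r, 2 * r, hr, by linarith⟩
  set Φ : Euc d → ℝ := fun y => χ y * φ y + (1 - χ y) * (g y + η / 2) with hΦ
  have hχ0 : ∀ y, 0 ≤ χ y := fun y => χ.nonneg
  have hχ1 : ∀ y, χ y ≤ 1 := fun y => χ.le_one
  have hone : ∀ y, ‖y - x‖ ≤ r → Φ y = φ y := fun y hy => by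
    have : χ y = 1 := χ.one_of_mem_closedBall (by simpa [dist_eq_norm] using hy)
    simp [hΦ, this]
  have hzero : ∀ y, 2 * r ≤ ‖y - x‖ → Φ y = g y + η / 2 := fun y hy => by
    have : χ y = 0 := χ.zero_of_le_dist (by simpa [dist_eq_norm] using hy)
    simp [hΦ, this]
  have hΦx : Φ x = u x := by rw [hone x (by simpa using hr.le), hx]
  have hΦ2 : ContDiff ℝ 2 Φ := by
    have hχc : ContDiff ℝ 2 χ := χ.contDiff
    have hgc : ContDiff ℝ 2 g := contDiff_infty.mp hg 2
    exact (hχc.mul hφ).add ((contDiff_const.sub hχc).mul (hgc.add contDiff_const))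
  refine ⟨Φ, hΦ2, ?_, ?_, hΦx, ?_, ?_, ?_, ?_⟩
  · obtain ⟨K, hK⟩ := (isCompact_closedBall x (2 * r)).exists_bound_of_continuousOn
      hΦ2.continuous.continuousOn
    refine ⟨max K (M + η), fun y => ?_⟩
    rcases le_or_gt ‖y - x‖ (2 * r) with h | h
    · exact le_max_of_le_left (hK y (by simpa [dist_eq_norm] using h))
    · refine le_max_of_le_right ?_
      have h1 := hgd' y
      have h2 := abs_le.mp (hM y)
      rw [hzero y h.le]
      exact abs_le.mpr ⟨by linarith, by linarith⟩
  · intro y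
    simp only [hΦ]
    nlinarith [hχ0 y, hχ1 y, hle y, (hgd' y).1]
  · refine Filter.EventuallyEq.fderiv_eq ?_
    filter_upwards [closedBall_mem_nhds x hr] with y hy
    exact hone y (by simpa [dist_eq_norm] using hy)
  · intro z hz
    exact (hone (x + z) (by simpa using hz.le)).le
  · intro z
    simp only [hΦ]
    nlinarith [hχ0 (x + z), hχ1 (x + z), hle (x + z), (hgd' (x + z)).2]
  · intro z hz
    rw [hzero (x + z) (by simpa using hz)]
    exact (hgd' (x + z)).2

lemma pair_estimate {p S m r : ℝ} (hp0 : 0 ≤ p) (hp2 : p ≤ 2) (hS : 0 ≤ S)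
    {a b : Euc d → ℝ} {z w : Euc d}
    (ha : a z ≤ (S + m) * ‖z‖ ^ p) (hb : -b w ≤ (S + m) * ‖w‖ ^ p)
    (hab : 2 * r ≤ ‖z‖ → 2 * r ≤ ‖w‖ →
      a z - b w ≤ S * ‖z - w‖ ^ p + m * ‖z‖ ^ p + m * ‖w‖ ^ p) :
    a z - b w ≤ 5 * S * ‖z - w‖ ^ p +
      (m * ‖z‖ ^ p + (ball (0 : Euc d) (4 * r)).indicator (fun z => S * ‖z‖ ^ p) z) +
      (m * ‖w‖ ^ p + (ball (0 : Euc d) (4 * r)).indicator (fun z => S * ‖z‖ ^ p) w) := by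
  have hind : ∀ z : Euc d,
      0 ≤ (ball (0 : Euc d) (4 * r)).indicator (fun z => S * ‖z‖ ^ p) z :=
    fun z => indicator_nonneg (fun z _ => by positivity) z
  have hz := hind z
  have hw := hind w
  have hd0 : 0 ≤ S * ‖z - w‖ ^ p := by positivity
  have hfar : ∀ z w : Euc d, ‖z‖ < 2 * r → 4 * r ≤ ‖w‖ →
      S * ‖z‖ ^ p + S * ‖w‖ ^ p ≤ 5 * S * ‖z - w‖ ^ p := by
    intro z w hz hw
    have h1 : ‖w‖ ≤ ‖z‖ + ‖z - w‖ := by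
      have := norm_sub_le z (z - w)
      simpa using this
    have h2 : ‖w‖ ^ p ≤ 4 * ‖z - w‖ ^ p := by
      calc ‖w‖ ^ p ≤ (2 * ‖z - w‖) ^ p := by gcongr; linarith
        _ = 2 ^ p * ‖z - w‖ ^ p := Real.mul_rpow (by norm_num) (norm_nonneg _)
        _ ≤ 4 * ‖z - w‖ ^ p := by
          gcongr
          calc (2 : ℝ) ^ p ≤ 2 ^ (2 : ℝ) := Real.rpow_le_rpow_of_exponent_le (by norm_num) hp2
            _ = 4 := by norm_num
    have h3 : ‖z‖ ^ p ≤ ‖z - w‖ ^ p := by gcongr; linarith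
    nlinarith
  have hin : ∀ z : Euc d, ‖z‖ < 4 * r →
      (ball (0 : Euc d) (4 * r)).indicator (fun z => S * ‖z‖ ^ p) z = S * ‖z‖ ^ p :=
    fun z hz => indicator_of_mem (by simpa using hz) _
  rcases lt_or_ge ‖z‖ (2 * r) with hz2 | hz2
  · rcases lt_or_ge ‖w‖ (4 * r) with hw4 | hw4
    · rw [hin z (by linarith [norm_nonneg z]), hin w hw4]
      linarith
    · linarith [hfar z w hz2 hw4]
  · rcases lt_or_ge ‖w‖ (2 * r) with hw2 | hw2
    · rcases lt_or_ge ‖z‖ (4 * r) with hz4 | hz4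
      · rw [hin z hz4, hin w (by linarith [norm_nonneg w])]
        linarith
      · have := hfar w z hw2 hz4
        rw [norm_sub_rev] at this
        linarith
    · linarith [hab hz2 hw2]

lemma Lop_eq_add {μ : Measure (Euc d)} {φ : Euc d → ℝ} {x : Euc d}
    (hi : Integrable (fun z => φ (x + z) - φ x -
      (ball (0 : Euc d) 1).indicator (fun w => fderiv ℝ φ x w) z) μ) :
    Lop μ φ x = ∫ z in ball (0 : Euc d) 1, (φ (x + z) - φ x - fderiv ℝ φ x z) ∂μ +
        ∫ z in (ball (0 : Euc d) 1)ᶜ, (φ (x + z) - φ x) ∂μ ∧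
      IntegrableOn (fun z => φ (x + z) - φ x - fderiv ℝ φ x z) (ball (0 : Euc d) 1) μ ∧
      IntegrableOn (fun z => φ (x + z) - φ x) (ball (0 : Euc d) 1)ᶜ μ := by
  have h1 : EqOn (fun z => φ (x + z) - φ x -
      (ball (0 : Euc d) 1).indicator (fun w => fderiv ℝ φ x w) z)
      (fun z => φ (x + z) - φ x - fderiv ℝ φ x z) (ball 0 1) := fun z hz => by
    simp only [indicator_of_mem hz]
  have h2 : EqOn (fun z => φ (x + z) - φ x -
      (ball (0 : Euc d) 1).indicator (fun w => fderiv ℝ φ x w) z)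
      (fun z => φ (x + z) - φ x) (ball 0 1)ᶜ := fun z hz => by
    simp only [indicator_of_notMem hz, sub_zero]
  refine ⟨?_, hi.integrableOn.congr_fun h1 measurableSet_ball,
    hi.integrableOn.congr_fun h2 measurableSet_ball.compl⟩
  rw [Lop, ← integral_add_compl measurableSet_ball hi,
    setIntegral_congr_fun measurableSet_ball h1,
    setIntegral_congr_fun measurableSet_ball.compl h2]

lemma measure_compl_ball_le {p : ℝ} (hp0 : 0 ≤ p) (μ : Measure (Euc d)) :
    μ (ball (0 : Euc d) 1)ᶜ ≤ ∫⁻ z, ENNReal.ofReal (min 1 (‖z‖ ^ p)) ∂μ := by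
  calc μ (ball (0 : Euc d) 1)ᶜ = ∫⁻ _ in (ball (0 : Euc d) 1)ᶜ, 1 ∂μ := by simp
    _ ≤ ∫⁻ z in (ball (0 : Euc d) 1)ᶜ, ENNReal.ofReal (min 1 (‖z‖ ^ p)) ∂μ := by
      refine setLIntegral_mono' measurableSet_ball.compl fun z hz => ?_
      have hz1 : 1 ≤ ‖z‖ := by simpa using hz
      rw [min_eq_left (Real.one_le_rpow hz1 hp0), ENNReal.ofReal_one]
    _ ≤ _ := setLIntegral_le_lintegral _ _

lemma setLIntegral_ball_rpow_le {p : ℝ} (hp0 : 0 ≤ p) (μ : Measure (Euc d)) :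
    ∫⁻ z in ball (0 : Euc d) 1, ENNReal.ofReal (‖z‖ ^ p) ∂μ ≤
      ∫⁻ z, ENNReal.ofReal (min 1 (‖z‖ ^ p)) ∂μ := by
  refine le_trans (setLIntegral_mono' measurableSet_ball fun z hz => ?_)
    (setLIntegral_le_lintegral (ball (0 : Euc d) 1) _)
  have hz1 : ‖z‖ < 1 := by simpa using hz
  rw [min_eq_right (Real.rpow_le_one (norm_nonneg z) hz1.le hp0)]

/-- Difference of two Lévy operators, given a coupling inequality for small jumps and a common
comparison function for large jumps. -/
lemma Lop_sub_Lop_le {p Λ : ℝ} (hp0 : 0 < p) (hp2 : p ≤ 2) (hΛ : 0 ≤ Λ) {Φ₁ Φ₂ : Euc d → ℝ}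
    (hΦ₁ : ContDiff ℝ 2 Φ₁) (hb₁ : ∃ M, ∀ x, |Φ₁ x| ≤ M)
    (hΦ₂ : ContDiff ℝ 2 Φ₂) (hb₂ : ∃ M, ∀ x, |Φ₂ x| ≤ M) {x y : Euc d} {μ₁ μ₂ : Measure (Euc d)}
    (h0₁ : μ₁ {0} = 0) (h0₂ : μ₂ {0} = 0)
    (hμ₁ : ∫⁻ z, ENNReal.ofReal (min 1 (‖z‖ ^ p)) ∂μ₁ ≤ ENNReal.ofReal Λ)
    (hμ₂ : ∫⁻ z, ENNReal.ofReal (min 1 (‖z‖ ^ p)) ∂μ₂ ≤ ENNReal.ofReal Λ)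
    {S m r t D T H κ₁ κ₂ : ℝ} (hS : 0 ≤ S) (hm : 0 ≤ m) (ht : 0 ≤ t) (hT : 0 ≤ T) (hH0 : 0 ≤ H)
    (hκ₁ : 0 ≤ κ₁) (hκ₂ : 0 ≤ κ₂)
    (ht₁ : ∫⁻ z in ball (0 : Euc d) (4 * r), ENNReal.ofReal (‖z‖ ^ p) ∂μ₁ ≤ ENNReal.ofReal t)
    (ht₂ : ∫⁻ z in ball (0 : Euc d) (4 * r), ENNReal.ofReal (‖z‖ ^ p) ∂μ₂ ≤ ENNReal.ofReal t)
    (hD : dLp p (μ₁.restrict (ball 0 1)) (μ₂.restrict (ball 0 1)) ≤ D)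
    (hTV : dTV (μ₁.restrict (ball 0 1)ᶜ) (μ₂.restrict (ball 0 1)ᶜ) ≤ ENNReal.ofReal T)
    (hnear : ∀ z ∈ ball (0 : Euc d) 1, ∀ w ∈ ball (0 : Euc d) 1,
      (Φ₁ (x + z) - Φ₁ x - fderiv ℝ Φ₁ x z) - (Φ₂ (y + w) - Φ₂ y - fderiv ℝ Φ₂ y w) ≤
      5 * S * ‖z - w‖ ^ p +
      (m * ‖z‖ ^ p + (ball (0 : Euc d) (4 * r)).indicator (fun z => S * ‖z‖ ^ p) z) +
      (m * ‖w‖ ^ p + (ball (0 : Euc d) (4 * r)).indicator (fun z => S * ‖z‖ ^ p) w))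
    {h : Euc d → ℝ} (hhm : Measurable h) (hhH : ∀ z, |h z| ≤ H)
    (hfar₁ : ∀ z, 1 ≤ ‖z‖ → Φ₁ (x + z) - Φ₁ x ≤ h z + κ₁)
    (hfar₂ : ∀ z, 1 ≤ ‖z‖ → h z - κ₂ ≤ Φ₂ (y + z) - Φ₂ y) :
    Lop μ₁ Φ₁ x - Lop μ₂ Φ₂ y ≤
      5 * S * D ^ p + 2 * (m * Λ + S * t) + (κ₁ + κ₂) * Λ + 3 * H * T := by
  obtain ⟨e₁, n₁, f₁⟩ := Lop_eq_add (integrable_levy_integrand hp0.le hp2 hΦ₁ hb₁ x hμ₁)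
  obtain ⟨e₂, n₂, f₂⟩ := Lop_eq_add (integrable_levy_integrand hp0.le hp2 hΦ₂ hb₂ y hμ₂)
  have hzero : ∀ μ : Measure (Euc d), μ {0} = 0 → μ.restrict (ball 0 1) {0} = 0 := fun μ hμ =>
    le_antisymm ((Measure.restrict_apply_le _ _).trans hμ.le) zero_le
  have hmom : ∀ μ : Measure (Euc d),
      ∫⁻ z, ENNReal.ofReal (min 1 (‖z‖ ^ p)) ∂μ ≤ ENNReal.ofReal Λ →
      ∫⁻ z in ball (0 : Euc d) 1, ENNReal.ofReal (‖z‖ ^ p) ∂μ ≤ ENNReal.ofReal Λ := fun μ hμ =>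
    (setLIntegral_ball_rpow_le hp0.le μ).trans hμ
  have hpm : Measurable fun z : Euc d => ‖z‖ ^ p := by fun_prop
  have hpint : ∀ (μ : Measure (Euc d)) (R : ℝ), 0 ≤ R →
      ∫⁻ z, ENNReal.ofReal (‖z‖ ^ p) ∂μ ≤ ENNReal.ofReal R →
      Integrable (fun z : Euc d => ‖z‖ ^ p) μ ∧ ∫ z, ‖z‖ ^ p ∂μ ≤ R := fun μ R hR hle =>
    ⟨(lintegral_ofReal_ne_top_iff_integrable hpm.aestronglyMeasurable
      (Eventually.of_forall fun z => by positivity)).mp (ne_top_of_le_ne_top (by finiteness) hle),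
    by
      rw [integral_eq_lintegral_of_nonneg_ae (Eventually.of_forall fun z => by positivity)
        hpm.aestronglyMeasurable]
      exact ENNReal.toReal_le_of_le_ofReal hR hle⟩
  set e : Euc d → ℝ := fun z =>
    m * ‖z‖ ^ p + (ball (0 : Euc d) (4 * r)).indicator (fun z => S * ‖z‖ ^ p) z with he
  have hem : Measurable e :=
    (hpm.const_mul m).add ((hpm.const_mul S).indicator measurableSet_ball)
  have heint : ∀ μ : Measure (Euc d),
      ∫⁻ z, ENNReal.ofReal (min 1 (‖z‖ ^ p)) ∂μ ≤ ENNReal.ofReal Λ →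
      ∫⁻ z in ball (0 : Euc d) (4 * r), ENNReal.ofReal (‖z‖ ^ p) ∂μ ≤ ENNReal.ofReal t →
      Integrable e (μ.restrict (ball 0 1)) ∧ ∫ z in ball 0 1, e z ∂μ ≤ m * Λ + S * t := by
    intro μ hμ hμt
    obtain ⟨i₁, l₁⟩ := hpint _ Λ hΛ (hmom μ hμ)
    obtain ⟨i₂, l₂⟩ := hpint ((μ.restrict (ball 0 1)).restrict (ball 0 (4 * r))) t ht (by
      refine (lintegral_mono' ?_ le_rfl).trans hμt
      exact Measure.restrict_mono le_rfl Measure.restrict_le_self)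
    have i₃ : Integrable ((ball (0 : Euc d) (4 * r)).indicator fun z => S * ‖z‖ ^ p)
        (μ.restrict (ball 0 1)) :=
      (integrable_indicator_iff measurableSet_ball).mpr (i₂.const_mul S)
    refine ⟨(i₁.const_mul m).add i₃, ?_⟩
    rw [he, integral_add (i₁.const_mul m) i₃, integral_indicator measurableSet_ball,
      integral_const_mul, integral_const_mul]
    gcongr
  obtain ⟨ei₁, el₁⟩ := heint μ₁ hμ₁ ht₁
  obtain ⟨ei₂, el₂⟩ := heint μ₂ hμ₂ ht₂
  have hcont : ∀ (Φ : Euc d → ℝ), Continuous Φ → ∀ x : Euc d,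
      Measurable fun z => Φ (x + z) - Φ x - fderiv ℝ Φ x z := fun Φ hΦ x =>
    ((hΦ.comp (continuous_const.add continuous_id)).measurable.sub_const _).sub
      (fderiv ℝ Φ x).continuous.measurable
  have hN := integral_sub_le_of_dLp_le (s := ball (0 : Euc d) 1) hp0 (by simp)
    (ae_restrict_mem measurableSet_ball) (ae_restrict_mem measurableSet_ball)
    (dLpPow_ne_top (hzero μ₁ h0₁) (hzero μ₂ h0₂)
      (ne_top_of_le_ne_top (by finiteness) (hmom μ₁ hμ₁))
      (ne_top_of_le_ne_top (by finiteness) (hmom μ₂ hμ₂)))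
    (hcont Φ₁ hΦ₁.continuous x) (hcont Φ₂ hΦ₂.continuous y) hem (by simp) (by simp)
    (by simp [he, Real.zero_rpow hp0.ne']) n₁ n₂ ei₁ ei₂
    (by positivity : 0 ≤ 5 * S) hD hnear
  have hmass : ∀ μ : Measure (Euc d),
      ∫⁻ z, ENNReal.ofReal (min 1 (‖z‖ ^ p)) ∂μ ≤ ENNReal.ofReal Λ →
      (μ.restrict (ball (0 : Euc d) 1)ᶜ) univ ≤ ENNReal.ofReal Λ := fun μ hμ => by
    rw [Measure.restrict_apply_univ]
    exact (measure_compl_ball_le hp0.le μ).trans hμ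
  have : IsFiniteMeasure (μ₁.restrict (ball (0 : Euc d) 1)ᶜ) :=
    ⟨(hmass μ₁ hμ₁).trans_lt (by finiteness)⟩
  have : IsFiniteMeasure (μ₂.restrict (ball (0 : Euc d) 1)ᶜ) :=
    ⟨(hmass μ₂ hμ₂).trans_lt (by finiteness)⟩
  have hhint : ∀ m : Measure (Euc d), IsFiniteMeasure m → Integrable h m := fun m _ =>
    Integrable.of_bound hhm.aestronglyMeasurable H (Eventually.of_forall hhH)
  have hF := integral_sub_le_of_dTV_le hhm hhH hH0 hT hTV
  have hF₁ : ∫ z in (ball (0 : Euc d) 1)ᶜ, (Φ₁ (x + z) - Φ₁ x) ∂μ₁ ≤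
      ∫ z in (ball (0 : Euc d) 1)ᶜ, h z ∂μ₁ + κ₁ * Λ := by
    calc _ ≤ ∫ z in (ball (0 : Euc d) 1)ᶜ, (h z + κ₁) ∂μ₁ :=
          setIntegral_mono_on f₁ ((hhint _ ‹_›).add (integrable_const κ₁))
            measurableSet_ball.compl fun z hz => hfar₁ z (by simpa using hz)
      _ = ∫ z in (ball (0 : Euc d) 1)ᶜ, h z ∂μ₁ +
          (μ₁.restrict (ball (0 : Euc d) 1)ᶜ).real univ * κ₁ := by
          rw [integral_add (hhint _ ‹_›) (integrable_const κ₁), integral_const, smul_eq_mul]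
      _ ≤ _ := by
          rw [mul_comm]
          gcongr
          exact ENNReal.toReal_le_of_le_ofReal hΛ (hmass μ₁ hμ₁)
  have hF₂ : ∫ z in (ball (0 : Euc d) 1)ᶜ, h z ∂μ₂ - κ₂ * Λ ≤
      ∫ z in (ball (0 : Euc d) 1)ᶜ, (Φ₂ (y + z) - Φ₂ y) ∂μ₂ := by
    calc _ ≤ ∫ z in (ball (0 : Euc d) 1)ᶜ, h z ∂μ₂ -
          (μ₂.restrict (ball (0 : Euc d) 1)ᶜ).real univ * κ₂ := by
          rw [mul_comm]
          gcongr
          exact ENNReal.toReal_le_of_le_ofReal hΛ (hmass μ₂ hμ₂)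
      _ = ∫ z in (ball (0 : Euc d) 1)ᶜ, (h z - κ₂) ∂μ₂ := by
          rw [integral_sub (hhint _ ‹_›) (integrable_const κ₂), integral_const, smul_eq_mul]
      _ ≤ _ :=
          setIntegral_mono_on ((hhint _ ‹_›).sub (integrable_const κ₂)) f₂
            measurableSet_ball.compl fun z hz => hfar₂ z (by simpa using hz)
  rw [e₁, e₂]
  linarith

/-- Existence and localisation of a maximum point in the doubling of variables. -/
lemma exists_doubling_max {u v : Euc d → ℝ} (hu : Continuous u) (hv : Continuous v) {Mu Mv : ℝ}
    (hMu : ∀ x, |u x| ≤ Mu) (hMv : ∀ x, |v x| ≤ Mv) {x₀ q : Euc d} (h0 : 0 < u x₀ - v x₀)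
    (hmax : ∀ x, u x - v x ≤ u x₀ - v x₀) {Ψ : Euc d → ℝ} (hΨ : Continuous Ψ) (hΨ0 : Ψ 0 = 0)
    (hΨnn : ∀ h, 0 ≤ Ψ h) {ε t ρ ω : ℝ} (hε : 0 < ε) (ht : 0 < t) (hρ : 0 < ρ)
    (hΨρ : ∀ h, ρ ≤ ‖h‖ → (Mu + Mv + ‖q‖ + 1) * (1 + ‖h‖) ≤ Ψ h)
    (hω : ∀ x y, ‖x - y‖ ≤ ρ → |v x - v y| ≤ ω) (hsmall : ω + ‖q‖ * ρ < ε * t ^ 2) :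
    ∃ x y : Euc d, ‖x - x₀‖ < t ∧ ‖x - y‖ < ρ ∧ u x₀ - v x₀ ≤ u x - v y + ‖q‖ * ρ ∧
      ∀ x' y', u x' - v y' - inner ℝ q (x' - y') - ε * ‖x' - x₀‖ ^ 2 - Ψ (x' - y') ≤
        u x - v y - inner ℝ q (x - y) - ε * ‖x - x₀‖ ^ 2 - Ψ (x - y) := by
  set F : Euc d × Euc d → ℝ := fun z =>
    u z.1 - v z.2 - inner ℝ q (z.1 - z.2) - ε * ‖z.1 - x₀‖ ^ 2 - Ψ (z.1 - z.2) with hF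
  have hFc : Continuous F := by fun_prop
  have hF0 : F (x₀, x₀) = u x₀ - v x₀ := by simp [hF, hΨ0]
  have hloc : ∀ z, F (x₀, x₀) ≤ F z → ‖z.1 - z.2‖ < ρ ∧ ‖z.1 - x₀‖ < t := by
    intro z hz
    rw [hF0] at hz
    simp only [hF] at hz
    have hq : -inner ℝ q (z.1 - z.2) ≤ ‖q‖ * ‖z.1 - z.2‖ := by
      simpa using real_inner_le_norm (-q) (z.1 - z.2)
    have he : 0 ≤ ε * ‖z.1 - x₀‖ ^ 2 := by positivity
    have hn := norm_nonneg (z.1 - z.2)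
    have h1 : ‖z.1 - z.2‖ < ρ := by
      by_contra! hcon
      have h2 := hΨρ _ hcon
      have h3 := abs_le.mp (hMu z.1)
      have h4 := abs_le.mp (hMv z.2)
      have h5 : 0 ≤ Mu := (abs_nonneg _).trans (hMu x₀)
      have h6 : 0 ≤ Mv := (abs_nonneg _).trans (hMv x₀)
      nlinarith [mul_nonneg h5 hn, mul_nonneg h6 hn, norm_nonneg q]
    refine ⟨h1, ?_⟩
    have h2 := (abs_le.mp (hω _ _ h1.le)).2
    have h3 := hmax z.1
    have h4 := hΨnn (z.1 - z.2)
    have h5 : ‖q‖ * ‖z.1 - z.2‖ ≤ ‖q‖ * ρ := by gcongr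
    have h6 : ε * ‖z.1 - x₀‖ ^ 2 < ε * t ^ 2 := by linarith
    exact lt_of_pow_lt_pow_left₀ 2 ht.le (lt_of_mul_lt_mul_left h6 hε.le)
  have hmem : ∀ z, F (x₀, x₀) ≤ F z → z ∈ closedBall x₀ t ×ˢ closedBall x₀ (t + ρ) := by
    intro z hz
    obtain ⟨h1, h2⟩ := hloc z hz
    refine ⟨by simpa [dist_eq_norm] using h2.le, ?_⟩
    rw [mem_closedBall, dist_eq_norm]
    have := norm_sub_le (z.1 - x₀) (z.1 - z.2)
    rw [show z.1 - x₀ - (z.1 - z.2) = z.2 - x₀ by abel] at this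
    linarith
  obtain ⟨z, -, hz⟩ := ((isCompact_closedBall x₀ t).prod
    (isCompact_closedBall x₀ (t + ρ))).exists_isMaxOn ⟨_, hmem _ le_rfl⟩ hFc.continuousOn
  have hz0 : F (x₀, x₀) ≤ F z := hz (hmem _ le_rfl)
  obtain ⟨h1, h2⟩ := hloc z hz0
  refine ⟨z.1, z.2, h2, h1, ?_, fun x' y' => ?_⟩
  · rw [hF0] at hz0
    simp only [hF] at hz0
    have hq : -inner ℝ q (z.1 - z.2) ≤ ‖q‖ * ‖z.1 - z.2‖ := by
      simpa using real_inner_le_norm (-q) (z.1 - z.2)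
    have he : 0 ≤ ε * ‖z.1 - x₀‖ ^ 2 := by positivity
    have h4 := hΨnn (z.1 - z.2)
    have h5 : ‖q‖ * ‖z.1 - z.2‖ ≤ ‖q‖ * ρ := by gcongr
    linarith
  · change F (x', y') ≤ F z
    rcases le_total (F (x₀, x₀)) (F (x', y')) with h | h
    · exact hz (hmem _ h)
    · exact h.trans hz0

lemma IsModulus.exists_forall_le {θ : ℝ → ℝ} (hθ : IsModulus θ) {τ : ℝ} (hτ : 0 < τ) :
    ∃ r > 0, ∀ s ≤ r, θ s ≤ τ := by
  obtain ⟨r, hr, hr0⟩ := ((hθ.2.2.eventually (gt_mem_nhds hτ)).and self_mem_nhdsWithin).exists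
  exact ⟨r, hr0, fun s hs => (hθ.2.1 hs).trans hr.le⟩

/-- A `C¹` function touched from above near `x₀` has test gradients close to its gradient at
`x₀`. -/
lemma exists_gradient_touching_above {u : Euc d → ℝ} {O : Set (Euc d)} (hO : IsOpen O)
    (hu : ContDiffOn ℝ 1 u O) {x₀ : Euc d} (hx₀ : x₀ ∈ O) :
    ∃ q : Euc d, ∀ ζ > 0, ∃ t > 0, ∀ x, ‖x - x₀‖ < t → ∀ (φ : Euc d → ℝ) (g : Euc d),
      (∀ x', u x' ≤ φ x') → u x = φ x → HasFDerivAt φ (innerSL ℝ g) x → ‖g - q‖ ≤ ζ := by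
  set q := (InnerProductSpace.toDual ℝ (Euc d)).symm (fderiv ℝ u x₀)
  refine ⟨q, fun ζ hζ => ?_⟩
  have hcont : ContinuousAt (fderiv ℝ u) x₀ :=
    (hu.continuousOn_fderiv_of_isOpen hO le_rfl).continuousAt (hO.mem_nhds hx₀)
  obtain ⟨t, ht, h⟩ := Metric.eventually_nhds_iff.mp
    ((hcont.eventually (Metric.ball_mem_nhds _ hζ)).and (hO.mem_nhds hx₀))
  refine ⟨t, ht, fun x hx φ g hle heq hφ => ?_⟩
  obtain ⟨h1, h2⟩ := h (by rwa [dist_eq_norm])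
  have hdu : HasFDerivAt u (fderiv ℝ u x) x :=
    ((hu.differentiableOn one_ne_zero).differentiableAt (hO.mem_nhds h2)).hasFDerivAt
  have hmin : IsLocalMin (fun x' => φ x' - u x') x := Eventually.of_forall fun x' => by
    simpa [heq] using hle x'
  have hz := sub_eq_zero.mp (hmin.hasFDerivAt_eq_zero (hφ.sub hdu))
  have hg : g = (InnerProductSpace.toDual ℝ (Euc d)).symm (fderiv ℝ u x) := by
    rw [← hz, LinearIsometryEquiv.eq_symm_apply]; rfl
  rw [hg, ← map_sub, LinearIsometryEquiv.norm_map, ← dist_eq_norm]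
  exact (mem_ball.mp h1).le

lemma exists_gradient_of_contDiffOn {u v : Euc d → ℝ} {O : Set (Euc d)} (hO : IsOpen O)
    (h : ContDiffOn ℝ 1 u O ∨ ContDiffOn ℝ 1 v O) {x₀ : Euc d} (hx₀ : x₀ ∈ O) :
    ∃ q : Euc d, ∀ ζ > 0, ∃ t > 0, ∀ x y, ‖x - x₀‖ < t → ‖y - x₀‖ < t →
      ∀ (φ φ' : Euc d → ℝ) (g g' : Euc d), (∀ x', u x' ≤ φ x') → u x = φ x →
        (∀ y', φ' y' ≤ v y') → φ' y = v y → HasFDerivAt φ (innerSL ℝ g) x →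
        HasFDerivAt φ' (innerSL ℝ g') y → ‖g - q‖ ≤ ζ ∨ ‖g' - q‖ ≤ ζ := by
  rcases h with h | h
  · obtain ⟨q, hq⟩ := exists_gradient_touching_above hO h hx₀
    refine ⟨q, fun ζ hζ => ?_⟩
    obtain ⟨t, ht, H⟩ := hq ζ hζ
    exact ⟨t, ht, fun x y hx _ φ φ' g g' h1 h2 _ _ h5 _ => .inl (H x hx φ g h1 h2 h5)⟩
  · obtain ⟨q, hq⟩ := exists_gradient_touching_above hO h.neg hx₀
    refine ⟨-q, fun ζ hζ => ?_⟩
    obtain ⟨t, ht, H⟩ := hq ζ hζ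
    refine ⟨t, ht, fun x y _ hy φ φ' g g' _ _ h3 h4 _ h6 => .inr ?_⟩
    have h7 : HasFDerivAt (fun y => -φ' y) (innerSL ℝ (-g')) y := by
      rw [map_neg]; exact h6.neg
    have := H y hy _ _ (fun x' => neg_le_neg (h3 x')) (by rw [h4]) h7
    rwa [← norm_neg, show -(-g' - q) = g' - -q by abel] at this

/-- The first-order information at a maximum point of the doubled function. -/
lemma exists_touching_functions {u v Ψ : Euc d → ℝ} {G : Euc d → Euc d}
    (hΨ : ContDiff ℝ 2 Ψ) (hG : ∀ h, HasFDerivAt Ψ (innerSL ℝ (G h)) h)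
    {ε : ℝ} {x₀ q x y : Euc d}
    (hmax : ∀ x' y', u x' - v y' - inner ℝ q (x' - y') - ε * ‖x' - x₀‖ ^ 2 - Ψ (x' - y') ≤
      u x - v y - inner ℝ q (x - y) - ε * ‖x - x₀‖ ^ 2 - Ψ (x - y)) :
    ∃ φ φ' : Euc d → ℝ, ContDiff ℝ 2 φ ∧ ContDiff ℝ 2 φ' ∧ (∀ x', u x' ≤ φ x') ∧ u x = φ x ∧
      (∀ y', φ' y' ≤ v y') ∧ φ' y = v y ∧
      HasFDerivAt φ (innerSL ℝ (q + (2 * ε) • (x - x₀) + G (x - y))) x ∧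
      HasFDerivAt φ' (innerSL ℝ (q + G (x - y))) y ∧
      (∀ z, φ (x + z) - φ x - fderiv ℝ φ x z =
        ε * ‖z‖ ^ 2 + (Ψ (x - y + z) - Ψ (x - y) - inner ℝ (G (x - y)) z)) ∧
      (∀ w, φ' (y + w) - φ' y - fderiv ℝ φ' y w =
        -(Ψ (x - y + -w) - Ψ (x - y) - inner ℝ (G (x - y)) (-w))) ∧
      ∀ z w, (u (x + z) - u x - fderiv ℝ φ x z) - (v (y + w) - v y - fderiv ℝ φ' y w) ≤
        ε * ‖z‖ ^ 2 + (Ψ (x - y + (z - w)) - Ψ (x - y) - inner ℝ (G (x - y)) (z - w)) := by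
  set φ : Euc d → ℝ := fun x' =>
    u x + inner ℝ q (x' - x) + ε * (‖x' - x₀‖ ^ 2 - ‖x - x₀‖ ^ 2) + (Ψ (x' - y) - Ψ (x - y))
    with hφ
  set φ' : Euc d → ℝ := fun y' => v y + inner ℝ q (y' - y) - (Ψ (x - y') - Ψ (x - y)) with hφ'
  have hd : HasFDerivAt φ (innerSL ℝ (q + (2 * ε) • (x - x₀) + G (x - y))) x := by
    have h1 : HasFDerivAt (fun x' : Euc d => inner ℝ q (x' - x)) (innerSL ℝ q) x :=
      (innerSL ℝ q).hasFDerivAt.comp x ((hasFDerivAt_id x).sub_const x)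
    have h2 : HasFDerivAt (fun x' : Euc d => ‖x' - x₀‖ ^ 2) _ x :=
      ((hasFDerivAt_id x).sub_const x₀).norm_sq
    have h3 : HasFDerivAt (fun x' => Ψ (x' - y)) _ x :=
      (hG (x - y)).comp x ((hasFDerivAt_id x).sub_const y)
    refine (((h1.const_add (u x)).add ((h2.sub_const _).const_mul ε)).add
      (h3.sub_const _)).congr_fderiv ?_
    ext z
    simp
    ring
  have hd' : HasFDerivAt φ' (innerSL ℝ (q + G (x - y))) y := by
    have h1 : HasFDerivAt (fun x' : Euc d => inner ℝ q (x' - y)) (innerSL ℝ q) y :=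
      (innerSL ℝ q).hasFDerivAt.comp y ((hasFDerivAt_id y).sub_const y)
    have h3 : HasFDerivAt (fun y' => Ψ (x - y')) _ y :=
      (hG (x - y)).comp y ((hasFDerivAt_id y).const_sub x)
    refine ((h1.const_add (v y)).sub (h3.sub_const _)).congr_fderiv ?_
    ext z
    simp
  have hsq : ∀ z, ‖x + z - x₀‖ ^ 2 = ‖x - x₀‖ ^ 2 + 2 * inner ℝ (x - x₀) z + ‖z‖ ^ 2 := fun z => by
    rw [show x + z - x₀ = x - x₀ + z by abel, norm_add_sq_real]
  have hin : ∀ a : Euc d, ContDiff ℝ 2 fun x' => inner ℝ q (x' - a) := fun a =>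
    contDiff_const.inner ℝ (by fun_prop)
  have hc : ContDiff ℝ 2 φ := by
    have := hin x
    have h2 : ContDiff ℝ 2 fun x' : Euc d => ‖x' - x₀‖ ^ 2 :=
      ContDiff.norm_sq ℝ (by fun_prop)
    fun_prop
  have hc' : ContDiff ℝ 2 φ' := by
    have := hin y
    fun_prop
  refine ⟨φ, φ', hc, hc', fun x' => ?_, by simp [hφ], fun y' => ?_, by simp [hφ'],
    hd, hd', fun z => ?_, fun w => ?_, fun z w => ?_⟩
  · have := hmax x' y
    rw [show x' - y = (x' - x) + (x - y) by abel, inner_add_right] at this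
    rw [show x' - x + (x - y) = x' - y by abel] at this
    simp only [hφ]
    linarith
  · have := hmax x y'
    rw [show inner ℝ q (x - y') = inner ℝ q (x - y) - inner ℝ q (y' - y) by
      rw [← inner_sub_right]; congr 1; abel] at this
    simp only [hφ']
    linarith
  · rw [hd.fderiv]
    simp only [hφ, hsq, innerSL_apply_apply, inner_add_left, inner_smul_left,
      add_sub_cancel_left, sub_self, inner_zero_right, show x + z - y = x - y + z by abel]
    simp
    ring
  · rw [hd'.fderiv]
    simp only [hφ', innerSL_apply_apply, inner_add_left, add_sub_cancel_left, sub_self,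
      inner_zero_right, inner_neg_right, show x - (y + w) = x - y + -w by abel]
    ring
  · have := hmax (x + z) (y + w)
    rw [hd.fderiv, hd'.fderiv]
    simp only [hsq, innerSL_apply_apply, inner_add_left, inner_smul_left, inner_sub_right,
      inner_add_right, show x + z - (y + w) = x - y + (z - w) by abel] at this ⊢
    simp only [conj_trivial] at *
    linarith

/-- Bounded test functions at a maximum point of the doubled function, with the estimates of
their second-order increments needed to compare the two nonlocal operators. -/
lemma exists_test_function_pair {p : ℝ} (hp1 : 1 < p) (hp2 : p ≤ 2) {u v Ψ : Euc d → ℝ}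
    (hu : IsBUC u) (hv : IsBUC v) {G : Euc d → Euc d} {L : ℝ} (hL : 0 ≤ L)
    (hΨ : ContDiff ℝ 2 Ψ) (hG : ∀ h, HasFDerivAt Ψ (innerSL ℝ (G h)) h)
    (hΨL : ∀ h k, Ψ (h + k) - Ψ h - inner ℝ (G h) k ≤ L * ‖k‖ ^ p)
    {ε : ℝ} (hε : 0 < ε) {x₀ q x y : Euc d}
    (hmax : ∀ x' y', u x' - v y' - inner ℝ q (x' - y') - ε * ‖x' - x₀‖ ^ 2 - Ψ (x' - y') ≤
      u x - v y - inner ℝ q (x - y) - ε * ‖x - x₀‖ ^ 2 - Ψ (x - y))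
    {r η : ℝ} (hr : 0 < r) (hη : 0 < η) (hηr : 2 * η ≤ ε * r ^ p) :
    ∃ Φ₁ Φ₂ : Euc d → ℝ, ContDiff ℝ 2 Φ₁ ∧ (∃ M, ∀ x', |Φ₁ x'| ≤ M) ∧
      ContDiff ℝ 2 Φ₂ ∧ (∃ M, ∀ y', |Φ₂ y'| ≤ M) ∧
      (∀ x', u x' ≤ Φ₁ x') ∧ Φ₁ x = u x ∧ (∀ y', Φ₂ y' ≤ v y') ∧ Φ₂ y = v y ∧
      (∀ z ∈ ball (0 : Euc d) 1, ∀ w ∈ ball (0 : Euc d) 1,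
        (Φ₁ (x + z) - Φ₁ x - fderiv ℝ Φ₁ x z) - (Φ₂ (y + w) - Φ₂ y - fderiv ℝ Φ₂ y w) ≤
        5 * L * ‖z - w‖ ^ p +
        (2 * ε * ‖z‖ ^ p + (ball (0 : Euc d) (4 * r)).indicator (fun z => L * ‖z‖ ^ p) z) +
        (2 * ε * ‖w‖ ^ p + (ball (0 : Euc d) (4 * r)).indicator (fun z => L * ‖z‖ ^ p) w)) ∧
      (∀ z, 2 * r ≤ ‖z‖ → Φ₁ (x + z) ≤ u (x + z) + η) ∧
      (∀ z, 2 * r ≤ ‖z‖ → v (y + z) - η ≤ Φ₂ (y + z)) := by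
  obtain ⟨φ, φ', hφ, hφ', hle, heq, hle', heq', -, -, hinc, hinc', hdoub⟩ :=
    exists_touching_functions hΨ hG hmax
  obtain ⟨Φ₁, c₁, b₁, le₁, eq₁, fd₁, near₁, mid₁, far₁⟩ := exists_test_function hu hφ hle heq hr hη
  have hvn : IsBUC fun y => -v y := ⟨by simpa using hv.1, hv.2.neg⟩
  obtain ⟨Φ, c₂, b₂, le₂, eq₂, fd₂, near₂, mid₂, far₂⟩ :=
    exists_test_function (x := y) hvn hφ'.neg (fun y' => neg_le_neg (hle' y')) (by rw [heq']) hr hη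
  have hfd : fderiv ℝ (fun y => -Φ y) y = fderiv ℝ φ' y := by
    rw [fderiv_fun_neg, fd₂, fderiv_fun_neg, neg_neg]
  have hηz : ∀ z : Euc d, r ≤ ‖z‖ → 2 * η ≤ ε * ‖z‖ ^ p := fun z hz =>
    hηr.trans (by gcongr)
  have hsq : ∀ z ∈ ball (0 : Euc d) 1, ε * ‖z‖ ^ 2 ≤ ε * ‖z‖ ^ p := fun z hz => by
    have hz1 : ‖z‖ ≤ 1 := (mem_ball_zero_iff.mp hz).le
    have := Real.rpow_le_rpow_of_exponent_ge' (norm_nonneg z) hz1 (by linarith) hp2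
    rw [Real.rpow_two] at this
    gcongr
  have hp0 : ∀ z : Euc d, 0 ≤ ε * ‖z‖ ^ p := fun z => by positivity
  refine ⟨Φ₁, fun y => -Φ y, c₁, b₁, c₂.neg, by simpa using b₂, le₁, eq₁,
    fun y' => by linarith [le₂ y'], by simp [eq₂], fun z hz w hw => ?_, far₁,
    fun z hz => by linarith [far₂ z hz]⟩
  refine pair_estimate (S := L) (m := 2 * ε) (r := r)
    (a := fun z => Φ₁ (x + z) - Φ₁ x - fderiv ℝ Φ₁ x z)
    (b := fun w => -Φ (y + w) - -Φ y - fderiv ℝ (fun y => -Φ y) y w)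
    (by linarith) hp2 hL ?_ ?_ fun hrz hrw => ?_
  · have h1 := hinc z
    have h2 := hΨL (x - y) z
    have h3 := hsq z hz
    have h4 := hp0 z
    simp only [fd₁, eq₁]
    rcases lt_or_ge ‖z‖ r with hzr | hzr
    · linarith [near₁ z hzr]
    · linarith [mid₁ z, hηz z hzr]
  · have h1 := hinc' w
    have h2 := hΨL (x - y) (-w)
    rw [norm_neg] at h2
    have h4 := hp0 w
    simp only [hfd, eq₂]
    rcases lt_or_ge ‖w‖ r with hwr | hwr
    · linarith [near₂ w hwr]
    · linarith [mid₂ w, hηz w hwr]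
  · have h1 := hdoub z w
    have h2 := hΨL (x - y) (z - w)
    have h3 := hsq z hz
    have h4 := hp0 w
    have h5 := hηz z (by linarith)
    simp only [fd₁, eq₁, hfd, eq₂]
    linarith [far₁ z hrz, far₂ w hrw]

lemma exists_global_max_of_bounded {w : Euc d → ℝ} (hw : Continuous w) {O : Set (Euc d)}
    (hO : Bornology.IsBounded O) (hout : ∀ x ∉ O, w x ≤ 0) {x₁ : Euc d} (hx₁ : x₁ ∈ O)
    (hpos : 0 < w x₁) : ∃ x₀ ∈ O, 0 < w x₀ ∧ ∀ x, w x ≤ w x₀ := by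
  obtain ⟨x₀, -, hmax⟩ := hO.isCompact_closure.exists_isMaxOn ⟨x₁, subset_closure hx₁⟩
    hw.continuousOn
  have h0 : 0 < w x₀ := hpos.trans_le (hmax (subset_closure hx₁))
  refine ⟨x₀, by_contra fun h => (hout x₀ h).not_gt h0, h0, fun x => ?_⟩
  by_cases hx : x ∈ O
  · exact hmax (subset_closure hx)
  · exact (hout x hx).trans h0.le

/-- Up to an error proportional to `ζ`, the maximum of `u - v` is nonpositive. -/
lemma exists_le_mul_max_of_C1 [Nonempty A] [Nonempty B] {O : Set (Euc d)} (hO : IsOpen O)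
    {p : ℝ} (hp1 : 1 < p) (hp2 : p ≤ 2)
    {μf : Euc d → A → B → Measure (Euc d)} {c f : A → B → Euc d → ℝ}
    (hLevy : ∀ x ∈ O, ∀ (α : A) (β : B), IsLevyLp p (μf x α β))
    (hA1 : AssumptionA1 O p (1 - 1 / p)
      (fun x α β => (μf x α β).restrict (ball (0 : Euc d) 1)))
    (hB : AssumptionB O (fun x α β => (μf x α β).restrict (ball (0 : Euc d) 1)ᶜ))
    (hC : AssumptionC O f) (hD : AssumptionD O c) (hE : AssumptionE O p μf)
    {u v : Euc d → ℝ} (hu : IsBUC u) (hv : IsBUC v)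
    (hsub : IsSubsolution O (Iop μf c f) u) (hsup : IsSupersolution O (Iop μf c f) v)
    (hC1 : ContDiffOn ℝ 1 u O ∨ ContDiffOn ℝ 1 v O)
    {x₀ : Euc d} (hx₀ : x₀ ∈ O) (hpos : 0 < u x₀ - v x₀)
    (hmax : ∀ x, u x - v x ≤ u x₀ - v x₀) :
    ∃ lam > 0, ∃ N : ℝ, ∀ ζ > 0, ζ ≤ u x₀ - v x₀ → lam * (u x₀ - v x₀) ≤ N * ζ := by
  obtain ⟨Mu, hMu⟩ := hu.1
  obtain ⟨Mv, hMv⟩ := hv.1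
  obtain ⟨CA, hCA, hA⟩ := hA1
  obtain ⟨θB, hθB, hB⟩ := hB
  obtain ⟨θC, hθC, Cf, hCf, hfc, hfb⟩ := hC
  obtain ⟨lam, lam1, hlam, hlam1, hcb, θD, hθD, hcc⟩ := hD
  obtain ⟨⟨θE, hθE, hEt⟩, Λ, hΛ, hEΛ⟩ := hE
  obtain ⟨q, hq⟩ := exists_gradient_of_contDiffOn hO hC1 hx₀
  have hMu0 : 0 ≤ Mu := (abs_nonneg _).trans (hMu 0)
  have hMv0 : 0 ≤ Mv := (abs_nonneg _).trans (hMv 0)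
  refine ⟨lam, hlam, lam + 7 * Mv + 5 + 150 * CA ^ p + 8 * Λ, fun ζ hζ hζM => ?_⟩
  obtain ⟨t₁, ht₁, hgrad⟩ := hq ζ hζ
  obtain ⟨t₂, ht₂, hball⟩ := Metric.isOpen_iff.mp hO x₀ hx₀
  obtain ⟨t, ht, ht1, ht2, ht3⟩ : ∃ t > 0, t ≤ 1 / 2 ∧ 2 * t ≤ t₁ ∧ 2 * t ≤ t₂ :=
    ⟨min (1 / 2) (min (t₁ / 2) (t₂ / 2)), by positivity, min_le_left _ _, by
      linarith [(min_le_right (1 / 2 : ℝ) _).trans (min_le_left (t₁ / 2) (t₂ / 2))], by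
      linarith [(min_le_right (1 / 2 : ℝ) _).trans (min_le_right (t₁ / 2) (t₂ / 2))]⟩
  set ω := ζ * t ^ 2 / 3 with hω_def
  have hω0 : 0 < ω := by positivity
  have htsq : t ^ 2 ≤ 1 := by nlinarith
  have hωζ : ω ≤ ζ := by
    have := mul_le_mul_of_nonneg_left htsq hζ.le
    linarith
  obtain ⟨ρv, hρv, hvρ⟩ := Metric.uniformContinuous_iff.mp hv.2 ω hω0
  obtain ⟨ρB, hρB, hθB'⟩ := hθB.exists_forall_le hζ
  obtain ⟨ρC, hρC, hθC'⟩ := hθC.exists_forall_le hζ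
  obtain ⟨ρD, hρD, hθD'⟩ := hθD.exists_forall_le hζ
  obtain ⟨ρ, hρ, hρt, hρv2, hρq, hρB2, hρC2, hρD2⟩ : ∃ ρ > 0, ρ ≤ t ∧ ρ < ρv ∧
      ρ ≤ ω / (‖q‖ + 1) ∧ ρ ≤ ρB ∧ ρ ≤ ρC ∧ ρ ≤ ρD := by
    have h : ∀ a > (0 : ℝ), ∀ᶠ ρ in nhdsWithin (0 : ℝ) (Ioi 0), ρ < a := fun a ha =>
      nhdsWithin_le_nhds (gt_mem_nhds ha)
    obtain ⟨ρ, h0, h1, h2, h3, h4, h5, h6⟩ := (eventually_mem_nhdsWithin.and <|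
      (h t ht).and <| (h ρv hρv).and <| (h (ω / (‖q‖ + 1)) (by positivity)).and <|
      (h ρB hρB).and <| (h ρC hρC).and (h ρD hρD)).exists
    exact ⟨ρ, h0, h1.le, h2, h3.le, h4.le, h5.le, h6.le⟩
  have hqρ : ‖q‖ * ρ ≤ ω := by
    rw [le_div_iff₀ (by positivity)] at hρq
    linarith
  have hvω : ∀ x y, ‖x - y‖ ≤ ρ → |v x - v y| ≤ ω := fun x y hxy => by
    have := hvρ (a := x) (b := y) (by rw [dist_eq_norm]; linarith)
    rw [Real.dist_eq] at this
    exact this.le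
  obtain ⟨Ψ, G, L, hL, hΨ, hΨ0, hΨnn, hG, hΨL, hΨρ, hLG⟩ :=
    exists_penalty (E := Euc d) hp1 hp2 hρ
      (show 0 < Mu + Mv + ‖q‖ + 1 by positivity) hζ
  obtain ⟨x, y, hxt, hxy, hval, hdoub⟩ :=
    exists_doubling_max hu.2.continuous hv.2.continuous hMu hMv hpos hmax hΨ.continuous hΨ0 hΨnn
      hζ ht hρ hΨρ hvω (by linarith)
  have hyt : ‖y - x₀‖ < 2 * t := by
    have := norm_sub_le (x - x₀) (x - y)
    rw [show x - x₀ - (x - y) = y - x₀ by abel] at this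
    linarith
  have hxO : x ∈ O := hball (by rw [mem_ball, dist_eq_norm]; linarith)
  have hyO : y ∈ O := hball (by rw [mem_ball, dist_eq_norm]; linarith)
  have hGle : ‖G (x - y)‖ ≤ 2 * ζ := by
    obtain ⟨φ, φ', -, -, hle, heq, hle', heq', hd, hd', -⟩ := exists_touching_functions hΨ hG hdoub
    have hn : ‖(2 * ζ) • (x - x₀)‖ ≤ ζ := by
      rw [norm_smul, Real.norm_of_nonneg (by positivity)]
      nlinarith
    rcases hgrad x y (by linarith) (by linarith) φ φ' _ _ hle heq hle' heq' hd hd' with h | h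
    · have := norm_sub_le (q + (2 * ζ) • (x - x₀) + G (x - y) - q) ((2 * ζ) • (x - x₀))
      rw [show q + (2 * ζ) • (x - x₀) + G (x - y) - q - (2 * ζ) • (x - x₀) = G (x - y) by abel]
        at this
      linarith
    · rw [add_sub_cancel_left] at h
      linarith
  obtain ⟨rE, hrE, hθE'⟩ := hθE.exists_forall_le (show 0 < ζ / (L + 1) by positivity)
  obtain ⟨r, hr, hr1, hr2⟩ : ∃ r > 0, 2 * r ≤ 1 ∧ 4 * r ≤ rE :=
    ⟨min (1 / 2) (rE / 4), by positivity, by linarith [min_le_left (1 / 2) (rE / 4)],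
      by linarith [min_le_right (1 / 2) (rE / 4)]⟩
  set η := ζ * min 1 (r ^ p) / 2 with hη_def
  have hrp : 0 < r ^ p := by positivity
  have hη : 0 < η := by positivity
  have hηr : 2 * η ≤ ζ * r ^ p := by
    have := mul_le_mul_of_nonneg_left (min_le_right 1 (r ^ p)) hζ.le
    linarith
  have hηζ : η ≤ ζ := by
    have := mul_le_mul_of_nonneg_left (min_le_left 1 (r ^ p)) hζ.le
    linarith
  obtain ⟨Φ₁, Φ₂, c₁, b₁, c₂, b₂, le₁, eq₁, le₂, eq₂, hnear, far₁, far₂⟩ :=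
    exists_test_function_pair hp1 hp2 hu hv hL hΨ hG hΨL hζ hdoub hr hη hηr
  have hp0 : 0 < p := by linarith
  have hF0 := hsub Φ₁ c₁ b₁ x hxO (fun y' => by linarith [le₁ y']) eq₁
  have hG0 := hsup Φ₂ c₂ b₂ y hyO (fun y' => by linarith [le₂ y']) eq₂
  have hbound : ∀ Φ : Euc d → ℝ, ContDiff ℝ 2 Φ → (∃ M, ∀ x, |Φ x| ≤ M) → ∀ x ∈ O,
      ∃ R, ∀ α β, |-(Lop (μf x α β) Φ x) + c α β x * Φ x + f α β x| ≤ R := by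
    intro Φ hΦ hb x hx
    obtain ⟨R, hR⟩ := exists_abs_Lop_le hp0.le hp2 hΛ hΦ hb x
    refine ⟨R + lam1 * |Φ x| + Cf, fun α β => (abs_add_three _ _ _).trans ?_⟩
    rw [abs_neg, abs_mul]
    gcongr
    · exact hR _ (hEΛ x hx α β)
    · rw [abs_of_pos (hlam.trans_le (hcb x hx α β).1)]
      exact (hcb x hx α β).2
    · exact hfb x hx α β
  obtain ⟨R₁, hR₁⟩ := hbound Φ₁ c₁ b₁ x hxO
  obtain ⟨R₂, hR₂⟩ := hbound Φ₂ c₂ b₂ y hyO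
  obtain ⟨α, β, hFα, hGα⟩ := exists_index_of_iSup_iInf (R := max R₁ R₂)
    (fun α β => (hR₁ α β).trans (le_max_left _ _)) (fun α β => (hR₂ α β).trans (le_max_right _ _))
    hF0 hG0 hζ
  have hsmall : ∀ x ∈ O, ∫⁻ z in ball (0 : Euc d) (4 * r), ENNReal.ofReal (‖z‖ ^ p) ∂(μf x α β) ≤
      ENNReal.ofReal (ζ / (L + 1)) := fun x hx =>
    (hEt (4 * r) (by positivity) x hx α β).trans (ENNReal.ofReal_le_ofReal (hθE' _ hr2))
  have hLop := Lop_sub_Lop_le hp0 hp2 hΛ c₁ b₁ c₂ b₂ (hLevy x hxO α β).1 (hLevy y hyO α β).1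
    (hEΛ x hxO α β) (hEΛ y hyO α β) hL (show 0 ≤ 2 * ζ by positivity)
    (show 0 ≤ ζ / (L + 1) by positivity) hζ.le (show 0 ≤ 2 * Mv by positivity)
    (show 0 ≤ 3 * ζ by positivity) hζ.le (hsmall x hxO) (hsmall y hyO) (hA x hxO y hyO α β)
    ((hB x hxO y hyO α β).trans
      (ENNReal.ofReal_le_ofReal (hθB' _ (hxy.le.trans hρB2)))) hnear
    (h := fun z => v (y + z) - v y)
    ((hv.2.continuous.comp (continuous_const.add continuous_id)).sub continuous_const).measurable
    (fun z => by
      have h1 := abs_le.mp (hMv (y + z))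
      have h2 := abs_le.mp (hMv y)
      exact abs_le.mpr ⟨by linarith, by linarith⟩)
    (fun z hz => by
      have h1 := far₁ z (by linarith)
      have h2 := hmax (x + z)
      have h3 := (abs_le.mp (hvω (x + z) (y + z) (by rw [add_sub_add_right_eq_sub]; exact hxy.le))).2
      rw [eq₁]
      linarith)
    (fun z hz => by
      have h1 := far₂ z (by linarith)
      rw [eq₂]
      linarith)
  have hDp : (CA * ‖x - y‖ ^ (1 - 1 / p)) ^ p = CA ^ p * ‖x - y‖ ^ (p - 1) := by
    rw [Real.mul_rpow hCA.le (by positivity), ← Real.rpow_mul (norm_nonneg _), sub_mul,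
      one_div_mul_cancel hp0.ne', one_mul]
  have hLD : 5 * L * (CA * ‖x - y‖ ^ (1 - 1 / p)) ^ p ≤ 150 * CA ^ p * ζ := by
    rw [hDp]
    have h1 : L * ‖x - y‖ ^ (p - 1) ≤ 30 * ζ := by linarith [hLG (x - y)]
    have h2 := mul_le_mul_of_nonneg_left h1 (show 0 ≤ 5 * CA ^ p by positivity)
    linarith
  have hLt : L * (ζ / (L + 1)) ≤ ζ := by
    rw [← mul_div_assoc, div_le_iff₀ (by positivity)]
    linarith
  have hcuv : lam * (u x₀ - v x₀ - ζ) ≤ c α β x * (u x - v y) :=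
    mul_le_mul (hcb x hxO α β).1 (by linarith) (by linarith)
      (hlam.le.trans (hcb x hxO α β).1)
  have hcv : -(ζ * Mv) ≤ (c α β x - c α β y) * v y := by
    refine (abs_le.mp ?_).1
    rw [abs_mul]
    exact mul_le_mul ((hcc x hxO y hyO α β).trans (hθD' _ (hxy.le.trans hρD2))) (hMv y)
      (abs_nonneg _) hζ.le
  have hff := (abs_le.mp ((hfc x hxO y hyO α β).trans (hθC' _ (hxy.le.trans hρC2)))).1
  rw [eq₁] at hFα
  rw [eq₂] at hGα
  linarith

/-- Theorem 6.3: comparison under Assumptions B–E and Assumption A1 with `p > 1` and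
`s = 1 - 1/p`, when one of the two functions is `C¹` on `𝒪`. -/
theorem comparison_with_C1_regularity
    {d : ℕ} {A B : Type*} [Nonempty A] [Nonempty B]
    (O : Set (Euc d)) (hOopen : IsOpen O) (hObdd : Bornology.IsBounded O)
    (hOconn : IsConnected O)
    (p : ℝ) (hp1 : 1 < p) (hp2 : p ≤ 2)
    (μf : Euc d → A → B → Measure (Euc d)) (c f : A → B → Euc d → ℝ)
    (hLevy : ∀ x ∈ O, ∀ (α : A) (β : B), IsLevyLp p (μf x α β))
    (hA1 : AssumptionA1 O p (1 - 1 / p)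
      (fun x α β => (μf x α β).restrict (ball (0 : Euc d) 1)))
    (hB : AssumptionB O (fun x α β => (μf x α β).restrict (ball (0 : Euc d) 1)ᶜ))
    (hC : AssumptionC O f) (hD : AssumptionD O c) (hE : AssumptionE O p μf)
    (u v : Euc d → ℝ) (hu : IsBUC u) (hv : IsBUC v)
    (hsub : IsSubsolution O (Iop μf c f) u)
    (hsup : IsSupersolution O (Iop μf c f) v)
    (hbc : ∀ x ∉ O, u x ≤ v x)
    (hC1 : ContDiffOn ℝ 1 u O ∨ ContDiffOn ℝ 1 v O) :
    ∀ x ∈ O, u x ≤ v x := by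
  intro x₁ hx₁
  by_contra! hlt
  have hw : Continuous fun x => u x - v x := hu.2.continuous.sub hv.2.continuous
  obtain ⟨x₀, hx₀, hpos, hmax⟩ := exists_global_max_of_bounded hw hObdd
    (fun x hx => sub_nonpos.mpr (hbc x hx)) hx₁ (sub_pos.mpr hlt)
  obtain ⟨lam, hlam, N, hN⟩ := exists_le_mul_max_of_C1 hOopen hp1 hp2 hLevy hA1 hB hC hD hE hu hv
    hsub hsup hC1 hx₀ hpos hmax
  have hlim : Tendsto (fun ζ : ℝ => N * ζ) (nhdsWithin 0 (Ioi 0)) (nhds 0) :=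
    ((continuous_const.mul continuous_id).tendsto' 0 0 (by simp)).mono_left nhdsWithin_le_nhds
  have hev : ∀ᶠ ζ in nhdsWithin (0 : ℝ) (Ioi 0), lam * (u x₀ - v x₀) ≤ N * ζ := by
    filter_upwards [Ioc_mem_nhdsGT hpos] with ζ hζ using hN ζ hζ.1 hζ.2
  exact (ge_of_tendsto hlim hev).not_gt (mul_pos hlam hpos)
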